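/- arXiv:1901.01121 — 12 statements merged into one kernel-verified Lean document; each statement's English description precedes it below -/
import Mathlib

section
/- Let (β_n)_{n≥0}, (α_n)_{n≥1}, (γ_n)_{n≥1} be sequences of complex numbers with γ_n ≠ 0 for all n ≥ 1, and define polynomials P_n ∈ ℂ[X] by P_{−1} := 0, P_0 := 1, P_1 := X − β_0, and P_{n+1}(X) = (X − β_n)P_n(X) − α_n P_{n−1}(X) − γ_{n−1} P_{n−2}(X) for n ≥ 1. Then the sequence {P_n} is threefold symmetric, i.e. P_n(ωX) = ω^n P_n(X) for all n ≥ 0, if and only if β_n = 0 for all n ≥ 0 and α_n = 0 for all n ≥ 1 (that is, if and only if the recurrence reduces to P_{n+1}(X) = X·P_n(X) − γ_{n−1} P_{n−2}(X) with P_0 = 1, P_1 = X, P_2 = X²). -/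
open Polynomial

/-- The coefficients in degrees `≥ n` of the `n`-th polynomial of a monic four-term recurrence. -/
theorem coeff_of_four_term_recurrence {R : Type*} [CommRing R] {β α γ : ℕ → R} {P : ℕ → R[X]}
    (hP0 : P 0 = 1) (hP1 : P 1 = X - C (β 0))
    (hP2 : P 2 = (X - C (β 1)) * P 1 - C (α 1) * P 0)
    (hPrec : ∀ n : ℕ, P (n + 3) =
      (X - C (β (n + 2))) * P (n + 2) - C (α (n + 2)) * P (n + 1) - C (γ (n + 1)) * P n)
    (n : ℕ) : (P n).coeff n = 1 ∧ ∀ m, n < m → (P n).coeff m = 0 := by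
  induction n using Nat.strong_induction_on with
  | _ n ih =>
    match n, ih with
    | 0, _ =>
      refine ⟨by simp [hP0], fun m hm => ?_⟩
      rw [hP0, coeff_one, if_neg (by omega)]
    | 1, _ =>
      refine ⟨by simp [hP1], fun m hm => ?_⟩
      rw [hP1, coeff_sub, coeff_X, coeff_C, if_neg (by omega), if_neg (by omega), sub_zero]
    | 2, ih =>
      have h0 := (ih 0 (by omega)).2
      have h1 := ih 1 (by omega)
      refine ⟨?_, fun m hm => ?_⟩
      · rw [hP2, sub_mul, coeff_sub, coeff_sub, coeff_X_mul, coeff_C_mul, coeff_C_mul, h1.1,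
          h1.2 _ (by omega), h0 _ (by omega)]
        ring
      · obtain ⟨m, rfl⟩ : ∃ k, m = k + 1 := ⟨m - 1, by omega⟩
        rw [hP2, sub_mul, coeff_sub, coeff_sub, coeff_X_mul, coeff_C_mul, coeff_C_mul,
          h1.2 _ (by omega), h1.2 _ (by omega), h0 _ (by omega)]
        ring
    | n + 3, ih =>
      have h0 := (ih n (by omega)).2
      have h1 := (ih (n + 1) (by omega)).2
      have h2 := ih (n + 2) (by omega)
      refine ⟨?_, fun m hm => ?_⟩
      · rw [hPrec, sub_mul, coeff_sub, coeff_sub, coeff_sub, coeff_X_mul, coeff_C_mul,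
          coeff_C_mul, coeff_C_mul, h2.1, h2.2 _ (by omega), h1 _ (by omega), h0 _ (by omega)]
        ring
      · obtain ⟨m, rfl⟩ : ∃ k, m = k + 1 := ⟨m - 1, by omega⟩
        rw [hPrec, sub_mul, coeff_sub, coeff_sub, coeff_sub, coeff_X_mul, coeff_C_mul,
          coeff_C_mul, coeff_C_mul, h2.2 _ (by omega), h2.2 _ (by omega), h1 _ (by omega),
          h0 _ (by omega)]
        ring

/-- Two polynomials with leading terms `X ^ (n + 1)` and `X ^ n` are linearly independent. -/
theorem eq_zero_of_C_mul_add_C_mul_eq_zero {R : Type*} [CommRing R] {p q : R[X]} {n : ℕ}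
    (hp : p.coeff (n + 1) = 1) (hq : q.coeff n = 1) (hq' : q.coeff (n + 1) = 0) {a b : R}
    (h : C a * p + C b * q = 0) : a = 0 ∧ b = 0 := by
  have ha : a = 0 := by
    simpa [hp, hq'] using congrArg (fun r : R[X] => r.coeff (n + 1)) h
  subst ha
  exact ⟨rfl, by simpa [hq] using congrArg (fun r : R[X] => r.coeff n) h⟩

/-- a 2-orthogonal-type four-term recurrence produces a threefold
symmetric polynomial sequence iff all β- and α-coefficients vanish. -/
theorem threefold_symmetric_iff_beta_alpha_zero
    (β α γ : ℕ → ℂ) (hγ : ∀ n : ℕ, 1 ≤ n → γ n ≠ 0)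
    (P : ℕ → Polynomial ℂ)
    (hP0 : P 0 = 1) (hP1 : P 1 = X - C (β 0))
    (hP2 : P 2 = (X - C (β 1)) * P 1 - C (α 1) * P 0)
    (hPrec : ∀ n : ℕ, P (n + 3) =
      (X - C (β (n + 2))) * P (n + 2) - C (α (n + 2)) * P (n + 1) - C (γ (n + 1)) * P n)
    (ω : ℂ) (hω : ω = Complex.exp (2 * Real.pi * Complex.I / 3)) :
    (∀ n : ℕ, (P n).comp (C ω * X) = C (ω ^ n) * P n) ↔
      ((∀ n : ℕ, β n = 0) ∧ (∀ n : ℕ, 1 ≤ n → α n = 0)) := by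
  have hprim : IsPrimitiveRoot ω 3 := by
    rw [hω]
    exact_mod_cast Complex.isPrimitiveRoot_exp 3 (by norm_num)
  have hω3 : ω ^ 3 = 1 := hprim.pow_eq_one
  have hω0 : ω ≠ 0 := hprim.ne_zero (by norm_num)
  have hω1 : ω - 1 ≠ 0 := sub_ne_zero.mpr (hprim.ne_one (by norm_num))
  have hω2 : ω ^ 2 - 1 ≠ 0 :=
    sub_ne_zero.mpr (hprim.pow_ne_one_of_pos_of_lt (by norm_num) (by norm_num))
  have hC3 : (C ω : ℂ[X]) ^ 3 = 1 := by rw [← C_pow, hω3, C_1]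
  constructor
  · intro h
    have hcoeff := coeff_of_four_term_recurrence hP0 hP1 hP2 hPrec
    have key : ∀ n : ℕ,
        C (β (n + 1) * (ω ^ (n + 1) * (ω - 1))) * P (n + 1) +
          C (α (n + 1) * (ω ^ n * (ω ^ 2 - 1))) * P n = 0 := by
      rintro (_ | n)
      · have e := h 2
        rw [hP2] at e
        simp only [sub_comp, mul_comp, X_comp, C_comp, h 0, h 1] at e
        simp only [C_mul, C_sub, C_pow, C_1, zero_add] at e ⊢
        linear_combination e
      · have e := h (n + 3)
        rw [hPrec] at e
        simp only [sub_comp, mul_comp, X_comp, C_comp, h n, h (n + 1), h (n + 2)] at e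
        simp only [C_mul, C_sub, C_pow, C_1] at e ⊢
        linear_combination e - C (γ (n + 1)) * C ω ^ n * P n * hC3
    have hzero : ∀ n : ℕ, β (n + 1) = 0 ∧ α (n + 1) = 0 := by
      intro n
      have hn := eq_zero_of_C_mul_add_C_mul_eq_zero (hcoeff (n + 1)).1 (hcoeff n).1
        ((hcoeff n).2 _ n.lt_succ_self) (key n)
      exact ⟨(mul_eq_zero.mp hn.1).resolve_right (mul_ne_zero (pow_ne_zero _ hω0) hω1),
        (mul_eq_zero.mp hn.2).resolve_right (mul_ne_zero (pow_ne_zero _ hω0) hω2)⟩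
    have hβ0 : β 0 = 0 := by
      have e := congrArg (fun r : ℂ[X] => r.coeff 0) (h 1)
      simp [hP1] at e
      exact (mul_eq_zero.mp (show β 0 * (ω - 1) = 0 by linear_combination -e)).resolve_right hω1
    refine ⟨fun n => ?_, fun n hn => ?_⟩
    · cases n with
      | zero => exact hβ0
      | succ n => exact (hzero n).1
    · obtain ⟨k, rfl⟩ : ∃ k, n = k + 1 := ⟨n - 1, by omega⟩
      exact (hzero k).2
  · rintro ⟨hβ, hα⟩ n
    induction n using Nat.strong_induction_on with
    | _ n ih =>
      match n, ih with
      | 0, _ => simp [hP0]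
      | 1, _ => simp [hP1, hβ]
      | 2, ih =>
        rw [hP2, hβ, hα 1 le_rfl]
        simp only [sub_comp, mul_comp, X_comp, zero_comp, C_0, ih 1 (by omega), C_pow]
        ring
      | n + 3, ih =>
        rw [hPrec, hβ, hα _ (by omega)]
        simp only [sub_comp, mul_comp, X_comp, C_comp, zero_comp, C_0, zero_mul, ih n (by omega),
          ih (n + 2) (by omega), C_pow]
        linear_combination C (γ (n + 1)) * C ω ^ n * P n * hC3
end

section
/- Let {P_n}_{n≥0} be a sequence of monic polynomials in ℂ[X] with deg P_n = n which is threefold symmetric, i.e. P_n(ωX) = ω^n P_n(X) for all n ≥ 0. Let u₀ and u₁ be linear functionals on ℂ[X] such that u₀(X^m P_n) = 0 whenever n ≥ 2m+1 and u₀(X^m P_{2m}) ≠ 0 for all m ≥ 0, and u₁(X^m P_n) = 0 whenever n ≥ 2m+2 and u₁(X^m P_{2m+1}) ≠ 0 for all m ≥ 0 (2-orthogonality). Then for all n ≥ 0: u₀(X^{3n+1}) = 0, u₀(X^{3n+2}) = 0, and u₁(X^{3n+2}) = 0. -/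
open Polynomial

/-- If `p (ω X) = ω ^ n p` for a primitive `d`-th root of unity `ω`, then `p` only involves
monomials whose exponents are congruent to `n` modulo `d`. -/
lemma coeff_eq_zero_of_comp_C_mul_X_eq {R : Type*} [CommRing R] [IsDomain R] {ω : R} {d : ℕ}
    [NeZero d] (hω : IsPrimitiveRoot ω d) {p : R[X]} {n : ℕ}
    (hp : p.comp (C ω * X) = C (ω ^ n) * p) {k : ℕ} (hk : ¬ k ≡ n [MOD d]) :
    p.coeff k = 0 := by
  have h : p.coeff k * ω ^ k = ω ^ n * p.coeff k := by
    rw [← comp_C_mul_X_coeff, hp, coeff_C_mul]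
  by_contra h0
  have hpow : ω ^ k = ω ^ n := mul_left_cancel₀ h0 (h.trans (mul_comm _ _))
  have hfin : IsOfFinOrder ω := hω.isOfFinOrder (NeZero.ne d)
  exact hk (hω.eq_orderOf ▸ hfin.pow_eq_pow_iff_modEq.mp hpow)

/-- If a linear functional annihilates every member with index congruent to `r` modulo `d` of a
`d`-fold symmetric monic polynomial sequence, then its moments of these orders vanish. -/
lemma moment_eq_zero_of_symmetric {R : Type*} [CommRing R] [IsDomain R] {ω : R} {d : ℕ}
    [NeZero d] (hω : IsPrimitiveRoot ω d) {P : ℕ → R[X]} (hmonic : ∀ n, (P n).Monic)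
    (hdeg : ∀ n, (P n).natDegree = n)
    (hsym : ∀ n, (P n).comp (C ω * X) = C (ω ^ n) * P n) {u : R[X] →ₗ[R] R} {r : ℕ}
    (hu : ∀ n, n ≡ r [MOD d] → u (P n) = 0) (n : ℕ) (hn : n ≡ r [MOD d]) :
    u (X ^ n) = 0 := by
  induction n using Nat.strong_induction_on with
  | _ n ih =>
    have h := hu n hn
    rw [(hmonic n).as_sum, hdeg, map_add, map_sum, Finset.sum_eq_zero, add_zero] at h
    · exact h
    · intro i hi
      rw [← smul_eq_C_mul, map_smul]
      by_cases hin : i ≡ n [MOD d]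
      · rw [ih i (Finset.mem_range.mp hi) (hin.trans hn), smul_zero]
      · rw [coeff_eq_zero_of_comp_C_mul_X_eq hω (hsym n) hin, zero_smul]

/-- a threefold symmetric 2-orthogonal sequence has a threefold
symmetric vector of orthogonality functionals: certain moments vanish. -/
theorem threefold_symmetric_functionals_moments_vanish
    (P : ℕ → Polynomial ℂ)
    (hmonic : ∀ n, (P n).Monic) (hdeg : ∀ n, (P n).natDegree = n)
    (ω : ℂ) (hω : ω = Complex.exp (2 * Real.pi * Complex.I / 3))
    (hsym : ∀ n : ℕ, (P n).comp (C ω * X) = C (ω ^ n) * P n)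
    (u₀ u₁ : Polynomial ℂ →ₗ[ℂ] ℂ)
    (h00 : ∀ m n : ℕ, 2 * m + 1 ≤ n → u₀ (X ^ m * P n) = 0)
    (h01 : ∀ m : ℕ, u₀ (X ^ m * P (2 * m)) ≠ 0)
    (h10 : ∀ m n : ℕ, 2 * m + 2 ≤ n → u₁ (X ^ m * P n) = 0)
    (h11 : ∀ m : ℕ, u₁ (X ^ m * P (2 * m + 1)) ≠ 0) :
    ∀ n : ℕ, u₀ (X ^ (3 * n + 1)) = 0 ∧ u₀ (X ^ (3 * n + 2)) = 0 ∧
      u₁ (X ^ (3 * n + 2)) = 0 := by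
  have hprim : IsPrimitiveRoot ω 3 := by
    have h := Complex.isPrimitiveRoot_exp 3 (by norm_num)
    rw [hω]
    exact_mod_cast h
  have hu₀ : ∀ n, 1 ≤ n → u₀ (P n) = 0 := fun n hn => by
    simpa using h00 0 n (by omega)
  have hu₁ : ∀ n, 2 ≤ n → u₁ (P n) = 0 := fun n hn => by
    simpa using h10 0 n (by omega)
  intro n
  refine ⟨moment_eq_zero_of_symmetric hprim hmonic hdeg hsym (r := 1) (fun k hk => hu₀ k ?_) _ ?_,
    moment_eq_zero_of_symmetric hprim hmonic hdeg hsym (r := 2) (fun k hk => hu₀ k ?_) _ ?_,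
    moment_eq_zero_of_symmetric hprim hmonic hdeg hsym (r := 2) (fun k hk => hu₁ k ?_) _ ?_⟩
  all_goals
    simp only [Nat.ModEq] at *
    omega
end

section
/- Let (γ_n)_{n≥1} be a sequence of nonzero complex numbers, extended by the convention γ_m := 0 for m ≤ 0, and let P_n be the monic polynomials defined by the threefold symmetric recurrence. Then for each j ∈ {0,1,2} there exists a unique sequence of monic polynomials P^{[j]}_n ∈ ℂ[X] with deg P^{[j]}_n = n such that P_{3n+j}(X) = X^j · P^{[j]}_n(X³) for all n ≥ 0 (the cubic decomposition), and these satisfy, with P^{[j]}_{−1} = P^{[j]}_{−2} := 0, the four-term recurrence P^{[j]}_{n+1}(x) = (x − β^{[j]}_n) P^{[j]}_n(x) − α^{[j]}_n P^{[j]}_{n−1}(x) − γ^{[j]}_{n−1} P^{[j]}_{n−2}(x) for all n ≥ 0, where β^{[j]}_n = γ_{3n−1+j} + γ_{3n+j} + γ_{3n+1+j}, α^{[j]}_n = γ_{3n−2+j}γ_{3n+j} + γ_{3n−1+j}γ_{3n−3+j} + γ_{3n−2+j}γ_{3n−1+j}, and γ^{[j]}_n = γ_{3n−2+j}γ_{3n+j}γ_{3n+2+j}.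 -/
open Polynomial

/-- The monic polynomials generated by a four-term recurrence with coefficients `β`, `α`, `δ`. -/
noncomputable def fourTermSeq {R : Type*} [CommRing R] (β α δ : ℕ → R) : ℕ → R[X]
  | 0 => 1
  | 1 => X - C (β 0)
  | 2 => (X - C (β 1)) * (X - C (β 0)) - C (α 1)
  | n + 3 => (X - C (β (n + 2))) * fourTermSeq β α δ (n + 2)
      - C (α (n + 2)) * fourTermSeq β α δ (n + 1) - C (δ (n + 1)) * fourTermSeq β α δ n

theorem isMonicOfDegree_fourTermSeq {R : Type*} [CommRing R] [Nontrivial R] (β α δ : ℕ → R) :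
    ∀ n, IsMonicOfDegree (fourTermSeq β α δ n) n
  | 0 => by simp [fourTermSeq]
  | 1 => by
    rw [fourTermSeq]
    exact isMonicOfDegree_X_sub_one _
  | 2 => by
    rw [fourTermSeq]
    exact ((isMonicOfDegree_X_sub_one _).mul (isMonicOfDegree_X_sub_one _)).sub (by simp)
  | n + 3 => by
    have h0 := isMonicOfDegree_fourTermSeq β α δ n
    have h1 := isMonicOfDegree_fourTermSeq β α δ (n + 1)
    have h2 := isMonicOfDegree_fourTermSeq β α δ (n + 2)
    rw [fourTermSeq]
    have h3 := (isMonicOfDegree_X_sub_one (β (n + 2))).mul h2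
    rw [show 1 + (n + 2) = n + 3 by ring] at h3
    refine (h3.sub ?_).sub ?_
    · have := natDegree_C_mul_le (α (n + 2)) (fourTermSeq β α δ (n + 1))
      have := h1.natDegree_eq
      lia
    · have := natDegree_C_mul_le (δ (n + 1)) (fourTermSeq β α δ n)
      have := h0.natDegree_eq
      lia

theorem threefold_step_three {R : Type*} [CommRing R] {γ : ℤ → R} {P : ℕ → R[X]}
    (hP : ∀ n : ℕ, P (n + 3) = X * P (n + 2) - C (γ ((n : ℤ) + 1)) * P n) (m : ℕ) :
    P (m + 9) = (X ^ 3 - C (γ (m + 5) + γ (m + 6) + γ (m + 7))) * P (m + 6)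
      - C (γ (m + 4) * γ (m + 6) + γ (m + 5) * γ (m + 3) + γ (m + 4) * γ (m + 5)) * P (m + 3)
      - C (γ (m + 1) * γ (m + 3) * γ (m + 5)) * P m := by
  have h (k : ℕ) : P (m + k + 3) = X * P (m + k + 2) - C (γ ((m : ℤ) + (k + 1))) * P (m + k) := by
    rw [hP]
    push_cast
    rw [add_assoc (m : ℤ)]
  have h0 := h 0
  have h2 := h 2
  have h3 := h 3
  have h4 := h 4
  have h5 := h 5
  have h6 := h 6
  norm_num [add_assoc] at h0 h2 h3 h4 h5 h6
  simp only [map_add, map_mul]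
  linear_combination h6 + X * h5 + X ^ 2 * h4 + C (γ (m + 6)) * h3
    + C (γ (m + 5)) * (h3 + X * h2 + C (γ (m + 3)) * h0)

/-- cubic decomposition of a threefold symmetric 2-orthogonal
sequence; the diagonal components satisfy an explicit four-term recurrence. -/
theorem cubic_decomposition_components
    (γ : ℤ → ℂ) (hγ1 : ∀ n : ℤ, 1 ≤ n → γ n ≠ 0) (hγ0 : ∀ n : ℤ, n ≤ 0 → γ n = 0)
    (P : ℕ → Polynomial ℂ)
    (hP0 : P 0 = 1) (hP1 : P 1 = X) (hP2 : P 2 = X ^ 2)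
    (hPrec : ∀ n : ℕ, P (n + 3) = X * P (n + 2) - C (γ ((n : ℤ) + 1)) * P n) :
    ∀ j : ℕ, j ≤ 2 →
      ∃ Q : ℕ → Polynomial ℂ,
        ((∀ n, (Q n).Monic) ∧ (∀ n, (Q n).natDegree = n) ∧
          (∀ n, P (3 * n + j) = X ^ j * (Q n).comp (X ^ 3))) ∧
        (Q 1 = (X - C (γ ((j : ℤ) - 1) + γ (j : ℤ) + γ ((j : ℤ) + 1))) * Q 0) ∧
        (Q 2 = (X - C (γ ((j : ℤ) + 2) + γ ((j : ℤ) + 3) + γ ((j : ℤ) + 4))) * Q 1 -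
           C (γ ((j : ℤ) + 1) * γ ((j : ℤ) + 3) + γ ((j : ℤ) + 2) * γ (j : ℤ) +
              γ ((j : ℤ) + 1) * γ ((j : ℤ) + 2)) * Q 0) ∧
        (∀ n : ℕ, Q (n + 3) =
          (X - C (γ (3 * (n : ℤ) + 5 + (j : ℤ)) + γ (3 * (n : ℤ) + 6 + (j : ℤ)) +
                  γ (3 * (n : ℤ) + 7 + (j : ℤ)))) * Q (n + 2)
          - C (γ (3 * (n : ℤ) + 4 + (j : ℤ)) * γ (3 * (n : ℤ) + 6 + (j : ℤ))
              + γ (3 * (n : ℤ) + 5 + (j : ℤ)) * γ (3 * (n : ℤ) + 3 + (j : ℤ))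
              + γ (3 * (n : ℤ) + 4 + (j : ℤ)) * γ (3 * (n : ℤ) + 5 + (j : ℤ))) * Q (n + 1)
          - C (γ (3 * (n : ℤ) + 1 + (j : ℤ)) * γ (3 * (n : ℤ) + 3 + (j : ℤ)) *
               γ (3 * (n : ℤ) + 5 + (j : ℤ))) * Q n) ∧
        (∀ Q' : ℕ → Polynomial ℂ,
          ((∀ n, (Q' n).Monic) ∧ (∀ n, (Q' n).natDegree = n) ∧
            (∀ n, P (3 * n + j) = X ^ j * (Q' n).comp (X ^ 3))) → Q' = Q) := by
  intro j hj
  let β : ℕ → ℂ := fun n => γ (3 * n - 1 + j) + γ (3 * n + j) + γ (3 * n + 1 + j)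
  let α : ℕ → ℂ := fun n => γ (3 * n - 2 + j) * γ (3 * n + j)
    + γ (3 * n - 1 + j) * γ (3 * n - 3 + j) + γ (3 * n - 2 + j) * γ (3 * n - 1 + j)
  let δ : ℕ → ℂ := fun n => γ (3 * n - 2 + j) * γ (3 * n + j) * γ (3 * n + 2 + j)
  have hmonic := isMonicOfDegree_fourTermSeq β α δ
  have h1 : fourTermSeq β α δ 1 =
      (X - C (γ ((j : ℤ) - 1) + γ (j : ℤ) + γ ((j : ℤ) + 1))) * fourTermSeq β α δ 0 := by
    simp only [fourTermSeq, β]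
    push_cast
    ring_nf
  have h2 : fourTermSeq β α δ 2 =
      (X - C (γ ((j : ℤ) + 2) + γ ((j : ℤ) + 3) + γ ((j : ℤ) + 4))) * fourTermSeq β α δ 1 -
        C (γ ((j : ℤ) + 1) * γ ((j : ℤ) + 3) + γ ((j : ℤ) + 2) * γ (j : ℤ) +
          γ ((j : ℤ) + 1) * γ ((j : ℤ) + 2)) * fourTermSeq β α δ 0 := by
    simp only [fourTermSeq, β, α]
    push_cast
    ring_nf
  have hrec : ∀ n : ℕ, fourTermSeq β α δ (n + 3) =
      (X - C (γ (3 * (n : ℤ) + 5 + (j : ℤ)) + γ (3 * (n : ℤ) + 6 + (j : ℤ)) +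
          γ (3 * (n : ℤ) + 7 + (j : ℤ)))) * fourTermSeq β α δ (n + 2)
        - C (γ (3 * (n : ℤ) + 4 + (j : ℤ)) * γ (3 * (n : ℤ) + 6 + (j : ℤ))
          + γ (3 * (n : ℤ) + 5 + (j : ℤ)) * γ (3 * (n : ℤ) + 3 + (j : ℤ))
          + γ (3 * (n : ℤ) + 4 + (j : ℤ)) * γ (3 * (n : ℤ) + 5 + (j : ℤ))) *
            fourTermSeq β α δ (n + 1)
        - C (γ (3 * (n : ℤ) + 1 + (j : ℤ)) * γ (3 * (n : ℤ) + 3 + (j : ℤ)) *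
          γ (3 * (n : ℤ) + 5 + (j : ℤ))) * fourTermSeq β α δ n := by
    intro n
    rw [fourTermSeq]
    simp only [β, α, δ]
    push_cast
    ring_nf
  have hdecomp : ∀ n, P (3 * n + j) = X ^ j * (fourTermSeq β α δ n).comp (X ^ 3) := by
    have hP3 := hPrec 0
    have hP4 := hPrec 1
    have hP5 := hPrec 2
    have hP6 := hPrec 3
    have hP7 := hPrec 4
    have hP8 := hPrec 5
    norm_num at hP3 hP4 hP5 hP6 hP7 hP8
    have hγz : γ 0 = 0 := hγ0 0 le_rfl
    have hγneg : γ (-1) = 0 := hγ0 (-1) (by norm_num)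
    intro n
    induction n using Nat.strong_induction_on with
    | _ n ih =>
    match n, ih with
    | 0, _ => interval_cases j <;> simp [fourTermSeq, hP0, hP1, hP2]
    | 1, _ =>
      rw [h1]
      interval_cases j <;> simp [fourTermSeq, hP0, hP1, hP2, hP3, hP4, hP5, hγz, hγneg] <;> ring
    | 2, _ =>
      rw [h2, h1]
      interval_cases j <;>
        simp [fourTermSeq, hP0, hP1, hP2, hP3, hP4, hP5, hP6, hP7, hP8, hγz, hγneg] <;> ring
    | n + 3, ih =>
      have e0 := ih n (by lia)
      have e1 := ih (n + 1) (by lia)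
      have e2 := ih (n + 2) (by lia)
      rw [show 3 * (n + 1) + j = 3 * n + j + 3 by ring] at e1
      rw [show 3 * (n + 2) + j = 3 * n + j + 6 by ring] at e2
      rw [show 3 * (n + 3) + j = 3 * n + j + 9 by ring, threefold_step_three hPrec, e0, e1, e2, hrec]
      simp only [sub_comp, mul_comp, X_comp, C_comp]
      push_cast
      simp only [add_right_comm _ (j : ℤ)]
      ring
  refine ⟨fourTermSeq β α δ, ⟨fun n => (hmonic n).monic, fun n => (hmonic n).natDegree_eq, hdecomp⟩,
    h1, h2, hrec, ?_⟩
  rintro Q' ⟨-, -, hQ'⟩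
  funext n
  have h := mul_left_cancel₀ (pow_ne_zero j X_ne_zero) ((hQ' n).symm.trans (hdecomp n))
  rw [← expand_eq_comp_X_pow, ← expand_eq_comp_X_pow] at h
  exact expand_injective (by norm_num) h
end

section
/- Let (γ_n)_{n≥1} be a sequence of nonzero complex numbers, let P_n be the monic polynomials defined by the threefold symmetric recurrence, and set Q_n := P_{n+1}′/(n+1) for n ≥ 0. Suppose there is a sequence (γ̃_n)_{n≥1} of complex numbers such that Q_{n+1}(X) = X·Q_n(X) − γ̃_{n−1}·Q_{n−2}(X) for all n ≥ 2. Then for all n ≥ 0: P_{n+3}(X) = Q_{n+3}(X) + ((n+1)γ_{n+2} − (n+3)γ̃_{n+1})·Q_n(X). -/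
open Polynomial

/-- if the monic derivatives of a threefold symmetric 2-orthogonal
sequence again satisfy a threefold symmetric recurrence, then the structural
relation P_{n+3} = Q_{n+3} + ((n+1)γ_{n+2} − (n+3)γ̃_{n+1}) Q_n holds. -/
theorem structural_relation_P_Q
    (γ : ℕ → ℂ) (hγ : ∀ n : ℕ, 1 ≤ n → γ n ≠ 0)
    (P : ℕ → Polynomial ℂ)
    (hP0 : P 0 = 1) (hP1 : P 1 = X) (hP2 : P 2 = X ^ 2)
    (hPrec : ∀ n : ℕ, P (n + 3) = X * P (n + 2) - C (γ (n + 1)) * P n)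
    (Q : ℕ → Polynomial ℂ)
    (hQdef : ∀ n : ℕ, Q n = C (((n : ℂ) + 1)⁻¹) * derivative (P (n + 1)))
    (γt : ℕ → ℂ)
    (hQrec : ∀ n : ℕ, Q (n + 3) = X * Q (n + 2) - C (γt (n + 1)) * Q n) :
    ∀ n : ℕ, P (n + 3) = Q (n + 3) +
      C (((n : ℂ) + 1) * γ (n + 2) - ((n : ℂ) + 3) * γt (n + 1)) * Q n := by
  intro n
  have derivative_P (m : ℕ) : derivative (P (m + 1)) = C ((m : ℂ) + 1) * Q m := by
    rw [hQdef, ← mul_assoc, ← C_mul, mul_inv_cancel₀ (Nat.cast_add_one_ne_zero m), C_1, one_mul]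
  have derivative_rec := congrArg derivative (hPrec (n + 1))
  simp only [derivative_sub, derivative_mul, derivative_X, derivative_C, zero_mul, one_mul,
    zero_add] at derivative_rec
  rw [show n + 1 + 3 = n + 3 + 1 by ring, show n + 1 + 2 = n + 2 + 1 by ring,
    derivative_P n, derivative_P (n + 2), derivative_P (n + 3)] at derivative_rec
  push_cast at derivative_rec
  simp only [map_add, map_sub, map_mul, map_one, map_ofNat, map_natCast] at derivative_rec ⊢
  linear_combination -derivative_rec + ((n : ℂ[X]) + 3) * hQrec n
end

section
/- Let γ₁ ∈ ℂ∖{0} and ϑ₁, ϑ₂ ∈ ℂ with ϑ₁ ≠ 2 and ϑ₂ ≠ 1/2. Suppose the linear functionals u₀, u₁ on ℂ[X] satisfy the system: ϑ₁·u₀′ + (1 − ϑ₁)·X·(u₁′) + (2 − ϑ₁)·u₁ = 0 and (2/γ₁)(1 − ϑ₂)·X²·(u₀′) + (2/γ₁)(3 − 2ϑ₂)·X·u₀ − (1 − 2ϑ₂)·u₁′ = 0. Then, with φ(X) := ϑ₁(2ϑ₂ − 1) − (2/γ₁)(ϑ₁ − 1)(ϑ₂ − 1)X³, one has: (φ·u₀)″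 + ((2/γ₁)(ϑ₂ + ϑ₁ − 2)·X²·u₀)′ + (2/γ₁)(ϑ₁ − 2)·X·u₀ = 0, and (ϑ₁ − 2)(2ϑ₂ − 1)·u₁ = φ·(u₀′) − (2/γ₁)(ϑ₁ − 1)(2ϑ₂ − 3)·X²·u₀. -/
open Polynomial

/-- The derivative of a linear functional on `ℂ[X]`: `u′(f) = −u(f′)`. -/
noncomputable def funD (u : Polynomial ℂ →ₗ[ℂ] ℂ) : Polynomial ℂ →ₗ[ℂ] ℂ :=
  -(u ∘ₗ (Polynomial.derivative : Polynomial ℂ →ₗ[ℂ] Polynomial ℂ))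

/-- Left multiplication of a linear functional on `ℂ[X]` by a polynomial:
`(g·u)(f) = u(g·f)`. -/
noncomputable def funM (g : Polynomial ℂ) (u : Polynomial ℂ →ₗ[ℂ] ℂ) :
    Polynomial ℂ →ₗ[ℂ] ℂ :=
  u ∘ₗ (LinearMap.mulLeft ℂ g)

theorem funD_apply (u : ℂ[X] →ₗ[ℂ] ℂ) (f : ℂ[X]) : funD u f = -u (derivative f) := rfl

theorem funM_apply (g : ℂ[X]) (u : ℂ[X] →ₗ[ℂ] ℂ) (f : ℂ[X]) : funM g u f = u (g * f) := rfl

theorem map_C_sub_C_mul_X_pow_mul (u : ℂ[X] →ₗ[ℂ] ℂ) (a c : ℂ) (n : ℕ) (f : ℂ[X]) :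
    u ((C a - C c * X ^ n) * f) = a * u f - c * u (X ^ n * f) := by
  rw [sub_mul, mul_assoc, C_mul', C_mul', map_sub, map_smul, map_smul, smul_eq_mul, smul_eq_mul]

theorem map_C_mul_X_pow_mul (u : ℂ[X] →ₗ[ℂ] ℂ) (c : ℂ) (n : ℕ) (f : ℂ[X]) :
    u (C c * X ^ n * f) = c * u (X ^ n * f) := by
  rw [mul_assoc, C_mul', map_smul, smul_eq_mul]

theorem map_derivative_X_pow_succ_mul (u : ℂ[X] →ₗ[ℂ] ℂ) (n : ℕ) (f : ℂ[X]) :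
    u (derivative (X ^ (n + 1) * f)) =
      (n + 1) * u (X ^ n * f) + u (X ^ (n + 1) * derivative f) := by
  rw [derivative_mul, derivative_X_pow_succ, mul_assoc, C_mul', map_add, map_smul, smul_eq_mul]

/-- the Pearson-type system for `(u₀,u₁)` implies the second order
equation for `u₀` and the expression of `u₁` in terms of `u₀`. -/
theorem pearson_system_implies_u0_equation_and_u1_formula
    (γ₁ ϑ₁ ϑ₂ : ℂ) (hγ₁ : γ₁ ≠ 0) (hϑ₁ : ϑ₁ ≠ 2) (hϑ₂ : ϑ₂ ≠ 1 / 2)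
    (u₀ u₁ : Polynomial ℂ →ₗ[ℂ] ℂ)
    (heq1 : ϑ₁ • funD u₀ + (1 - ϑ₁) • funM X (funD u₁) + (2 - ϑ₁) • u₁ = 0)
    (heq2 : ((2 / γ₁) * (1 - ϑ₂)) • funM (X ^ 2) (funD u₀)
        + ((2 / γ₁) * (3 - 2 * ϑ₂)) • funM X u₀ - (1 - 2 * ϑ₂) • funD u₁ = 0) :
    funD (funD (funM (C (ϑ₁ * (2 * ϑ₂ - 1)) -
          C ((2 / γ₁) * (ϑ₁ - 1) * (ϑ₂ - 1)) * X ^ 3) u₀))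
      + funD (funM (C ((2 / γ₁) * (ϑ₂ + ϑ₁ - 2)) * X ^ 2) u₀)
      + ((2 / γ₁) * (ϑ₁ - 2)) • funM X u₀ = 0 ∧
    ((ϑ₁ - 2) * (2 * ϑ₂ - 1)) • u₁ =
      funM (C (ϑ₁ * (2 * ϑ₂ - 1)) -
          C ((2 / γ₁) * (ϑ₁ - 1) * (ϑ₂ - 1)) * X ^ 3) (funD u₀)
        - ((2 / γ₁) * (ϑ₁ - 1) * (2 * ϑ₂ - 3)) • funM (X ^ 2) u₀ := by
  have pearson₁ (f : ℂ[X]) := LinearMap.congr_fun heq1 f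
  have pearson₂ (f : ℂ[X]) := LinearMap.congr_fun heq2 f
  have deriv_X_sq (u : ℂ[X] →ₗ[ℂ] ℂ) (f : ℂ[X]) :
      u (derivative (X ^ 2 * f)) = 2 * u (X * f) + u (X ^ 2 * derivative f) := by
    rw [map_derivative_X_pow_succ_mul u 1 f]
    norm_num
  have deriv_X_cube (u : ℂ[X] →ₗ[ℂ] ℂ) (f : ℂ[X]) :
      u (derivative (X ^ 3 * f)) = 3 * u (X ^ 2 * f) + u (X ^ 3 * derivative f) := by
    rw [map_derivative_X_pow_succ_mul u 2 f]
    norm_num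
  have X_mul_X (f : ℂ[X]) : X * (X * f) = X ^ 2 * f := by ring
  have X_sq_mul_X (f : ℂ[X]) : X ^ 2 * (X * f) = X ^ 3 * f := by ring
  simp only [LinearMap.add_apply, LinearMap.sub_apply, LinearMap.smul_apply, smul_eq_mul,
    LinearMap.zero_apply, funD_apply, funM_apply] at pearson₁ pearson₂
  have u₁_formula (f : ℂ[X]) :
      (ϑ₁ - 2) * (2 * ϑ₂ - 1) * u₁ f = -(ϑ₁ * (2 * ϑ₂ - 1) * u₀ (derivative f)
        - (2 / γ₁) * (ϑ₁ - 1) * (ϑ₂ - 1) * u₀ (derivative (X ^ 3 * f)))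
        - (2 / γ₁) * (ϑ₁ - 1) * (2 * ϑ₂ - 3) * u₀ (X ^ 2 * f) := by
    have h := pearson₂ (X * f)
    rw [X_mul_X, X_sq_mul_X] at h
    linear_combination (1 - 2 * ϑ₂) * pearson₁ f + (1 - ϑ₁) * h
  refine ⟨LinearMap.ext fun f => ?_, LinearMap.ext fun f => ?_⟩
  · simp only [LinearMap.add_apply, LinearMap.smul_apply, smul_eq_mul, LinearMap.zero_apply,
      funD_apply, funM_apply, map_C_sub_C_mul_X_pow_mul, map_C_mul_X_pow_mul]
    have h₁ := u₁_formula (derivative f)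
    have h₂ := pearson₂ f
    rw [deriv_X_cube] at h₁
    rw [deriv_X_sq] at h₂
    linear_combination h₁ + (ϑ₁ - 2) * h₂
  · simp only [LinearMap.sub_apply, LinearMap.smul_apply, smul_eq_mul, funD_apply, funM_apply]
    have h := map_C_sub_C_mul_X_pow_mul (u₀ ∘ₗ derivative) (ϑ₁ * (2 * ϑ₂ - 1))
      ((2 / γ₁) * (ϑ₁ - 1) * (ϑ₂ - 1)) 3 f
    simp only [LinearMap.comp_apply] at h
    rw [u₁_formula, h]
end

section
/- Let γ₁ ∈ ℂ∖{0} and ϑ₁, ϑ₂ ∈ ℂ with ϑ₁ ≠ (k−1)/k and ϑ₂ ≠ (k−1)/k for every integer k ≥ 1, and set φ(X) := ϑ₁(2ϑ₂ − 1) − (2/γ₁)(ϑ₁ − 1)(ϑ₂ − 1)X³. Suppose the linear functional u₀ on ℂ[X] satisfies (φ·u₀)″ + ((2/γ₁)(ϑ₂ + ϑ₁ − 2)·X²·u₀)′ + (2/γ₁)(ϑ₁ − 2)·X·u₀ = 0 together with (u₀)₀ = 1 and (u₀)₁ = (u₀)₂ = 0. Then for all n ≥ 0: (u₀)_{3n+1}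 = (u₀)_{3n+2} = 0, and (2/γ₁)·((3n+1) − (3n+2)ϑ₂)·(3n − (3n+1)ϑ₁)·(u₀)_{3n+3} = (3n+1)(3n+2)·ϑ₁(2ϑ₂ − 1)·(u₀)_{3n}. -/
open Polynomial

/-- Evaluating the distributional equation at `X ^ (k + 2)` gives a three-step recursion
for the moments. -/
theorem moment_recursion (γ₁ ϑ₁ ϑ₂ : ℂ) (u₀ : Polynomial ℂ →ₗ[ℂ] ℂ)
    (heq : funD (funD (funM (C (ϑ₁ * (2 * ϑ₂ - 1)) -
            C ((2 / γ₁) * (ϑ₁ - 1) * (ϑ₂ - 1)) * X ^ 3) u₀))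
        + funD (funM (C ((2 / γ₁) * (ϑ₂ + ϑ₁ - 2)) * X ^ 2) u₀)
        + ((2 / γ₁) * (ϑ₁ - 2)) • funM X u₀ = 0) (k : ℕ) :
    (2 / γ₁) * (((k : ℂ) + 1) - ((k : ℂ) + 2) * ϑ₂) *
        ((k : ℂ) - ((k : ℂ) + 1) * ϑ₁) * u₀ (X ^ (k + 3)) =
      ((k : ℂ) + 1) * ((k : ℂ) + 2) * ϑ₁ * (2 * ϑ₂ - 1) * u₀ (X ^ k) := by
  have h := LinearMap.congr_fun heq (X ^ (k + 2))
  have hd : derivative (X ^ (k + 2) : ℂ[X]) = ((k : ℂ) + 2) • X ^ (k + 1) := by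
    rw [derivative_X_pow, smul_eq_C_mul]
    push_cast
    simp
  have hd' : derivative (X ^ (k + 1) : ℂ[X]) = ((k : ℂ) + 1) • X ^ k := by
    rw [derivative_X_pow, smul_eq_C_mul]
    push_cast
    simp
  have hφ (a b : ℂ) : (C a - C b * X ^ 3) * X ^ k = a • X ^ k - b • X ^ (k + 3) := by
    simp only [smul_eq_C_mul]
    ring
  have hψ (c : ℂ) : C c * X ^ 2 * X ^ (k + 1) = c • X ^ (k + 3) := by
    rw [smul_eq_C_mul]
    ring
  have hX : (X : ℂ[X]) * X ^ (k + 2) = X ^ (k + 3) := by ring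
  simp only [funD, funM, LinearMap.add_apply, LinearMap.neg_apply, LinearMap.comp_apply,
    LinearMap.smul_apply, LinearMap.mulLeft_apply, LinearMap.zero_apply, hd, hd',
    hφ, hψ, hX, map_smul, map_sub, smul_eq_mul] at h
  linear_combination -h

/-- The leading factors of the recursion do not vanish. -/
theorem sub_mul_ne_zero_of_ne_div {ϑ : ℂ}
    (h : ∀ k : ℕ, 1 ≤ k → ϑ ≠ ((k : ℂ) - 1) / k) (k : ℕ) :
    (k : ℂ) - ((k : ℂ) + 1) * ϑ ≠ 0 := by
  have hk : (k : ℂ) + 1 ≠ 0 := Nat.cast_add_one_ne_zero k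
  intro h0
  apply h (k + 1) (by omega)
  push_cast
  rw [eq_div_iff hk]
  linear_combination -h0

/-- the moment equations for `u₀` derived from the second order
distributional equation. -/
theorem moments_u0_recursion
    (γ₁ ϑ₁ ϑ₂ : ℂ) (hγ₁ : γ₁ ≠ 0)
    (h1 : ∀ k : ℕ, 1 ≤ k → ϑ₁ ≠ ((k : ℂ) - 1) / k)
    (h2 : ∀ k : ℕ, 1 ≤ k → ϑ₂ ≠ ((k : ℂ) - 1) / k)
    (u₀ : Polynomial ℂ →ₗ[ℂ] ℂ)
    (heq : funD (funD (funM (C (ϑ₁ * (2 * ϑ₂ - 1)) -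
            C ((2 / γ₁) * (ϑ₁ - 1) * (ϑ₂ - 1)) * X ^ 3) u₀))
        + funD (funM (C ((2 / γ₁) * (ϑ₂ + ϑ₁ - 2)) * X ^ 2) u₀)
        + ((2 / γ₁) * (ϑ₁ - 2)) • funM X u₀ = 0)
    (hm0 : u₀ (X ^ 0) = 1) (hm1 : u₀ (X ^ 1) = 0) (hm2 : u₀ (X ^ 2) = 0) :
    ∀ n : ℕ, u₀ (X ^ (3 * n + 1)) = 0 ∧ u₀ (X ^ (3 * n + 2)) = 0 ∧
      (2 / γ₁) * ((3 * (n : ℂ) + 1) - (3 * (n : ℂ) + 2) * ϑ₂) *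
          ((3 * (n : ℂ)) - (3 * (n : ℂ) + 1) * ϑ₁) * u₀ (X ^ (3 * n + 3)) =
        (3 * (n : ℂ) + 1) * (3 * (n : ℂ) + 2) * ϑ₁ * (2 * ϑ₂ - 1) * u₀ (X ^ (3 * n)) := by
  have hrec := moment_recursion γ₁ ϑ₁ ϑ₂ u₀ heq
  have hstep (k : ℕ) (hk : u₀ (X ^ k) = 0) : u₀ (X ^ (k + 3)) = 0 := by
    have h := hrec k
    rw [hk, mul_zero] at h
    have hϑ₂ : ((k : ℂ) + 1) - ((k : ℂ) + 2) * ϑ₂ ≠ 0 := by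
      have h' := sub_mul_ne_zero_of_ne_div h2 (k + 1)
      push_cast at h'
      rwa [add_assoc (k : ℂ) 1 1, one_add_one_eq_two] at h'
    exact (mul_eq_zero.mp h).resolve_left (mul_ne_zero
      (mul_ne_zero (div_ne_zero two_ne_zero hγ₁) hϑ₂) (sub_mul_ne_zero_of_ne_div h1 k))
  intro n
  refine ⟨?_, ?_, by simpa using hrec (3 * n)⟩
  · induction n with
    | zero => exact hm1
    | succ n ih => exact hstep (3 * n + 1) ih
  · induction n with
    | zero => exact hm2
    | succ n ih => exact hstep (3 * n + 2) ih
end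

section
/- Let γ₁ ∈ ℂ∖{0} and ϑ₁, ϑ₂ ∈ ℂ with ϑ₁ ≠ 2 and ϑ₁, ϑ₂ ≠ (k−1)/k for every integer k ≥ 1, and set φ(X) := ϑ₁(2ϑ₂ − 1) − (2/γ₁)(ϑ₁ − 1)(ϑ₂ − 1)X³. Suppose the linear functional u₀ on ℂ[X] satisfies (φ·u₀)″ + ((2/γ₁)(ϑ₂ + ϑ₁ − 2)·X²·u₀)′ + (2/γ₁)(ϑ₁ − 2)·X·u₀ = 0 with (u₀)₀ = 1 and (u₀)₁ = (u₀)₂ = 0, and define the linear functional u₁ by (ϑ₁ − 2)(2ϑ₂ − 1)·u₁ = φ·(u₀′) − (2/γ₁)(ϑ₁ − 1)(2ϑ₂ − 3)·X²·u₀. Then for all n ≥ 0: (u₁)_{3n} = (u₁)_{3n+2} = 0, and (ϑ₁ − 2)(2ϑ₂ − 1)·(u₁)_{3n+1} = (2/γ₁)(ϑ₁ − 1)·((3n+2)ϑ₂ − (3n+1))·(u₀)_{3n+3} − (3n+1)·ϑ₁(2ϑ₂ − 1)·(u₀)_{3n}. -/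
open Polynomial

/-- Moments of `(φ·u)″ + (c X²·u)′ + e X·u` for `φ = a - b X³`. -/
lemma moment_second_order (a b c e : ℂ) (u : Polynomial ℂ →ₗ[ℂ] ℂ) (m : ℕ) :
    (funD (funD (funM (C a - C b * X ^ 3) u)) + funD (funM (C c * X ^ 2) u)
        + e • funM X u) (X ^ (m + 2)) =
      a * ((m : ℂ) + 2) * ((m : ℂ) + 1) * u (X ^ m)
        - (b * ((m : ℂ) + 2) * ((m : ℂ) + 1) + c * ((m : ℂ) + 2) - e) * u (X ^ (m + 3)) := by
  have hD : derivative (X ^ (m + 2) : ℂ[X]) = ((m : ℂ) + 2) • X ^ (m + 1) := by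
    rw [derivative_X_pow, smul_eq_C_mul]; push_cast; rfl
  have hD' : derivative (X ^ (m + 1) : ℂ[X]) = ((m : ℂ) + 1) • X ^ m := by
    simp [smul_eq_C_mul]
  have hφ : (C a - C b * X ^ 3) * X ^ m = a • X ^ m - b • X ^ (m + 3) := by
    simp only [smul_eq_C_mul]; ring
  have hψ : C c * X ^ 2 * X ^ (m + 1) = c • (X ^ (m + 3) : ℂ[X]) := by
    simp only [smul_eq_C_mul]; ring
  have hX : X * X ^ (m + 2) = (X ^ (m + 3) : ℂ[X]) := by ring
  simp only [funD, funM, LinearMap.add_apply, LinearMap.neg_apply, LinearMap.smul_apply,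
    LinearMap.comp_apply, LinearMap.mulLeft_apply, hD, hD', map_smul, hφ, hψ, hX, map_sub,
    smul_eq_mul]
  ring

/-- Moments of `φ·(u′) - c X²·u` for `φ = a - b X³`. -/
lemma moment_first_order (a b c : ℂ) (u : Polynomial ℂ →ₗ[ℂ] ℂ) (m : ℕ) :
    (funM (C a - C b * X ^ 3) (funD u) - c • funM (X ^ 2) u) (X ^ m) =
      (b * ((m : ℂ) + 3) - c) * u (X ^ (m + 2)) - a * (m : ℂ) * u (X ^ (m - 1)) := by
  have hφ : (C a - C b * X ^ 3) * X ^ m = a • X ^ m - b • X ^ (m + 3) := by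
    simp only [smul_eq_C_mul]; ring
  have hD : derivative (X ^ m : ℂ[X]) = (m : ℂ) • X ^ (m - 1) := by
    rw [derivative_X_pow, smul_eq_C_mul]
  have hD' : derivative (X ^ (m + 3) : ℂ[X]) = ((m : ℂ) + 3) • X ^ (m + 2) := by
    rw [derivative_X_pow, smul_eq_C_mul]; push_cast; rfl
  have hX : X ^ 2 * X ^ m = (X ^ (m + 2) : ℂ[X]) := by ring
  simp only [funD, funM, LinearMap.sub_apply, LinearMap.neg_apply, LinearMap.smul_apply,
    LinearMap.comp_apply, LinearMap.mulLeft_apply, hφ, hD, hD', map_smul, hX, map_sub,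
    smul_eq_mul]
  ring

/-- If `ϑ ≠ k / (k + 1)` then `(k + 1)(ϑ - 1) + 1 ≠ 0`. -/
lemma succ_mul_sub_one_add_one_ne_zero {ϑ : ℂ}
    (h : ∀ k : ℕ, 1 ≤ k → ϑ ≠ ((k : ℂ) - 1) / k) (k : ℕ) :
    ((k : ℂ) + 1) * (ϑ - 1) + 1 ≠ 0 := by
  intro h0
  have hk : (k : ℂ) + 1 ≠ 0 := Nat.cast_add_one_ne_zero k
  refine h (k + 1) (by omega) ?_
  push_cast
  rw [eq_div_iff hk]
  linear_combination h0

/-- the moment equations for the second functional `u₁`. -/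
theorem moments_u1_recursion
    (γ₁ ϑ₁ ϑ₂ : ℂ) (hγ₁ : γ₁ ≠ 0) (hϑ₁2 : ϑ₁ ≠ 2)
    (h1 : ∀ k : ℕ, 1 ≤ k → ϑ₁ ≠ ((k : ℂ) - 1) / k)
    (h2 : ∀ k : ℕ, 1 ≤ k → ϑ₂ ≠ ((k : ℂ) - 1) / k)
    (u₀ u₁ : Polynomial ℂ →ₗ[ℂ] ℂ)
    (heq : funD (funD (funM (C (ϑ₁ * (2 * ϑ₂ - 1)) -
            C ((2 / γ₁) * (ϑ₁ - 1) * (ϑ₂ - 1)) * X ^ 3) u₀))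
        + funD (funM (C ((2 / γ₁) * (ϑ₂ + ϑ₁ - 2)) * X ^ 2) u₀)
        + ((2 / γ₁) * (ϑ₁ - 2)) • funM X u₀ = 0)
    (hm0 : u₀ (X ^ 0) = 1) (hm1 : u₀ (X ^ 1) = 0) (hm2 : u₀ (X ^ 2) = 0)
    (hu₁ : ((ϑ₁ - 2) * (2 * ϑ₂ - 1)) • u₁ =
      funM (C (ϑ₁ * (2 * ϑ₂ - 1)) -
          C ((2 / γ₁) * (ϑ₁ - 1) * (ϑ₂ - 1)) * X ^ 3) (funD u₀)
        - ((2 / γ₁) * (ϑ₁ - 1) * (2 * ϑ₂ - 3)) • funM (X ^ 2) u₀) :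
    ∀ n : ℕ, u₁ (X ^ (3 * n)) = 0 ∧ u₁ (X ^ (3 * n + 2)) = 0 ∧
      (ϑ₁ - 2) * (2 * ϑ₂ - 1) * u₁ (X ^ (3 * n + 1)) =
        (2 / γ₁) * (ϑ₁ - 1) * ((3 * (n : ℂ) + 2) * ϑ₂ - (3 * (n : ℂ) + 1)) *
            u₀ (X ^ (3 * n + 3))
          - (3 * (n : ℂ) + 1) * ϑ₁ * (2 * ϑ₂ - 1) * u₀ (X ^ (3 * n)) := by
  have hrec : ∀ m : ℕ, u₀ (X ^ m) = 0 → u₀ (X ^ (m + 3)) = 0 := by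
    intro m hm
    have h := LinearMap.congr_fun heq (X ^ (m + 2))
    rw [moment_second_order, hm, LinearMap.zero_apply] at h
    have hq := succ_mul_sub_one_add_one_ne_zero h2 (m + 1)
    push_cast at hq
    have hne := mul_ne_zero (mul_ne_zero (div_ne_zero two_ne_zero hγ₁)
      (succ_mul_sub_one_add_one_ne_zero h1 m)) hq
    refine (mul_eq_zero.mp ?_).resolve_left hne
    linear_combination -h
  have hz1 : ∀ n : ℕ, u₀ (X ^ (3 * n + 1)) = 0 := by
    intro n
    induction n with
    | zero => exact hm1
    | succ n ih => exact hrec _ ih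
  have hz2 : ∀ n : ℕ, u₀ (X ^ (3 * n + 2)) = 0 := by
    intro n
    induction n with
    | zero => exact hm2
    | succ n ih => exact hrec _ ih
  have hK : (ϑ₁ - 2) * (2 * ϑ₂ - 1) ≠ 0 := by
    refine mul_ne_zero (sub_ne_zero.mpr hϑ₁2) fun h => ?_
    refine succ_mul_sub_one_add_one_ne_zero h2 1 ?_
    push_cast
    linear_combination h
  have hmom := fun m : ℕ => LinearMap.congr_fun hu₁ (X ^ m)
  simp only [moment_first_order, LinearMap.smul_apply, smul_eq_mul] at hmom
  intro n
  refine ⟨(mul_eq_zero.mp ?_).resolve_left hK, (mul_eq_zero.mp ?_).resolve_left hK, ?_⟩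
  · rw [hmom, hz2]
    cases n with
    | zero => simp
    | succ n =>
      rw [show 3 * (n + 1) - 1 = 3 * n + 2 by omega, hz2]
      ring
  · rw [hmom, show 3 * n + 2 - 1 = 3 * n + 1 by omega,
      show 3 * n + 2 + 2 = 3 * (n + 1) + 1 by ring, hz1, hz1]
    ring
  · rw [hmom, Nat.add_sub_cancel]
    push_cast
    ring
end

section
/- Let ϑ₁, ϑ₂ ∈ ℂ with ϑ₁ ≠ (k−1)/k and ϑ₂ ≠ (k−1)/k for every integer k ≥ 1, and define ϑ_n for n ≥ 1 as in the ϑ-recursion. Let (γ_n)_{n≥1} be nonzero complex numbers, let P_n be the monic polynomials defined by the threefold symmetric recurrence, and set Q_n := P_{n+1}′/(n+1). Then the following are equivalent: (i) for every n ≥ 0, (n+1)·((n+4)(ϑ_{n+1} − 1) + 1)·γ_{n+2} = (n+3)·(n(ϑ_n − 1) + 1)·γ_{n+1}, where for n = 0 the factor n(ϑ_n − 1) + 1 is taken to be 1; (ii) Q_{n+1}(X) = X·Q_n(X) − γ̃_{n−1}·Q_{n−2}(X) for all n ≥ 2, where γ̃_m := (m/(m+2))·ϑ_m·γ_{m+1}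 for m ≥ 1. -/
open Polynomial

/-- Polynomials generated by a threefold symmetric recurrence have degree equal to their index. -/
lemma degree_of_threefold_symmetric_recurrence {γ : ℕ → ℂ} {P : ℕ → Polynomial ℂ}
    (hP0 : P 0 = 1) (hP1 : P 1 = X) (hP2 : P 2 = X ^ 2)
    (hPrec : ∀ n : ℕ, P (n + 3) = X * P (n + 2) - C (γ (n + 1)) * P n) (n : ℕ) :
    (P n).degree = n := by
  induction n using Nat.strong_induction_on with
  | _ n ih =>
    match n with
    | 0 => simp [hP0]
    | 1 => simp [hP1]
    | 2 => simp [hP2]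
    | n + 3 =>
      have hX : (X * P (n + 2)).degree = ((n + 3 : ℕ) : WithBot ℕ) := by
        rw [degree_mul, degree_X, ih (n + 2) (by omega), add_comm]
        rfl
      have hlt : (C (γ (n + 1)) * P n).degree < (X * P (n + 2)).degree := by
        rw [hX, ← smul_eq_C_mul]
        refine (degree_smul_le _ _).trans_lt ?_
        rw [ih n (by omega)]
        exact_mod_cast (by omega : n < n + 3)
      rw [hPrec, degree_sub_eq_left_of_degree_lt hlt, hX]

lemma theta_denominator_ne_zero {t : ℂ} (ht : ∀ k : ℕ, 1 ≤ k → t ≠ ((k : ℂ) - 1) / k) (n : ℕ) :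
    (n : ℂ) * t - ((n : ℂ) - 1) ≠ 0 := by
  rcases Nat.eq_zero_or_pos n with rfl | hn
  · simp
  · intro h
    have hn0 : (n : ℂ) ≠ 0 := by exact_mod_cast hn.ne'
    exact ht n hn (by rw [eq_div_iff hn0]; linear_combination h)

lemma one_sub_theta_succ_mul_theta {t : ℂ}
    (ht : ∀ k : ℕ, 1 ≤ k → t ≠ ((k : ℂ) - 1) / k) (n : ℕ) :
    (1 - (((n + 1 : ℕ) + 1) * t - (n + 1 : ℕ)) / ((n + 1 : ℕ) * t - ((n + 1 : ℕ) - 1))) *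
        (((n + 1) * t - n) / (n * t - (n - 1))) =
      1 - ((n + 1) * t - n) / (n * t - (n - 1)) := by
  have ha := theta_denominator_ne_zero ht n
  have hb := theta_denominator_ne_zero ht (n + 1)
  push_cast at hb ⊢
  have hc : ((n : ℂ) + 1) * t - n ≠ 0 := by
    convert hb using 1; ring
  rw [show ((n : ℂ) + 1) * t - (n + 1 - 1) = (n + 1) * t - n by ring]
  field_simp
  ring

/-- If the monic derivatives `Q` satisfy the recurrence below index `n`, then at index `n` the
recurrence fails by a multiple of `Q n`, which vanishes exactly when the relation between
`γ (n + 1)` and `γ (n + 2)` holds. -/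
lemma recurrence_defect {θ γ : ℕ → ℂ}
    (hθ : ∀ n : ℕ, (1 - θ (n + 3)) * θ (n + 1) = 1 - θ (n + 1))
    {P Q : ℕ → Polynomial ℂ}
    (hP0 : P 0 = 1) (hP1 : P 1 = X) (hP2 : P 2 = X ^ 2)
    (hPrec : ∀ n : ℕ, P (n + 3) = X * P (n + 2) - C (γ (n + 1)) * P n)
    (hQdef : ∀ n : ℕ, Q n = C (((n : ℂ) + 1)⁻¹) * derivative (P (n + 1)))
    (n : ℕ)
    (hQ : ∀ k < n, Q (k + 3) = X * Q (k + 2)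
      - C ((((k : ℂ) + 1) / ((k : ℂ) + 3)) * θ (k + 1) * γ (k + 2)) * Q k) :
    C (((n : ℂ) + 3) * ((n : ℂ) + 4)) * (Q (n + 3) - (X * Q (n + 2)
      - C ((((n : ℂ) + 1) / ((n : ℂ) + 3)) * θ (n + 1) * γ (n + 2)) * Q n)) =
    C (((n : ℂ) + 1) * (((n : ℂ) + 4) * (θ (n + 1) - 1) + 1) * γ (n + 2) -
        ((n : ℂ) + 3) * ((n : ℂ) * (θ n - 1) + 1) * γ (n + 1)) * Q n := by
  have hcast (m : ℕ) : (C ((m : ℂ) + 1) : Polynomial ℂ) * Q m = derivative (P (m + 1)) := by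
    rw [hQdef, ← mul_assoc, ← C_mul, mul_inv_cancel₀ (Nat.cast_add_one_ne_zero m), C_1, one_mul]
  have hD (m : ℕ) : C ((m : ℂ) + 4) * Q (m + 3) = P (m + 3) + C ((m : ℂ) + 3) * (X * Q (m + 2))
      - C (((m : ℂ) + 1) * γ (m + 2)) * Q m := by
    have e3 := hcast (m + 3)
    have e2 := hcast (m + 2)
    have e0 := hcast m
    rw [show m + 3 + 1 = m + 1 + 3 by ring, hPrec (m + 1)] at e3
    simp only [derivative_sub, derivative_mul, derivative_X, derivative_C] at e3
    rw [show m + 1 + 2 = m + 2 + 1 by ring, ← e2, ← e0] at e3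
    push_cast at e3
    simp only [C_add, C_mul, C_1, C_ofNat] at e3 ⊢
    linear_combination e3
  have hg (m : ℕ) : C ((m : ℂ) + 3) *
      C ((((m : ℂ) + 1) / ((m : ℂ) + 3)) * θ (m + 1) * γ (m + 2)) =
        (C (((m : ℂ) + 1) * θ (m + 1) * γ (m + 2)) : Polynomial ℂ) := by
    rw [← C_mul]
    have : (m : ℂ) + 3 ≠ 0 := by exact_mod_cast (by omega : m + 3 ≠ 0)
    congr 1
    field_simp
  have hA (m : ℕ) (hm : m < n) :
      P (m + 3) = Q (m + 3) + C (((m : ℂ) + 1) * γ (m + 2) * (1 - θ (m + 1))) * Q m := by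
    have h := hD m
    have hq := hQ m hm
    have hgm := hg m
    simp only [C_add, C_mul, C_sub, C_1, C_ofNat] at h hq hgm ⊢
    linear_combination -h + (C (m : ℂ) + 3) * hq - Q m * hgm
  have hQ0 : Q 0 = 1 := by simp [hQdef, hP1]
  have hQ1 : Q 1 = X := by
    have h := hcast 1
    simp only [hP2, derivative_X_pow] at h
    apply mul_left_cancel₀ (C_ne_zero.2 (show ((1 : ℕ) : ℂ) + 1 ≠ 0 by norm_num))
    rw [h]; norm_num
  have hQ2 : Q 2 = X ^ 2 := by
    have h := hcast 2
    rw [hPrec 0] at h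
    simp only [hP2, hP0, derivative_sub, derivative_mul, derivative_X_pow, derivative_X,
      derivative_C, derivative_one] at h
    apply mul_left_cancel₀ (C_ne_zero.2 (show ((2 : ℕ) : ℂ) + 1 ≠ 0 by norm_num))
    rw [h]
    simp only [Nat.cast_ofNat, C_add, C_ofNat, C_1]
    ring
  have hP : P (n + 3) = X * Q (n + 2) +
      C ((n : ℂ) * γ (n + 1) * (1 - θ n) - γ (n + 1)) * Q n := by
    rw [hPrec]
    match n with
    | 0 => simp [hP0, hP2, hQ0, hQ2]; ring
    | 1 =>
      rw [hA 0 (by omega), hP1, hQ0, hQ1]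
      simp only [C_mul, C_sub, C_1, Nat.cast_zero, Nat.cast_one, zero_add]
      ring
    | 2 =>
      rw [hA 1 (by omega), hP2, hQ1, hQ2]
      simp only [C_add, C_mul, C_sub, C_1, Nat.cast_one, Nat.cast_ofNat, C_ofNat]
      ring
    | n + 3 =>
      rw [show n + 3 + 2 = n + 2 + 3 by ring, hA (n + 2) (by omega), hA n (by omega)]
      have hq := hQ n (by omega)
      have hgn := hg n
      have ht := congrArg (C : ℂ → Polynomial ℂ) (hθ n)
      push_cast
      simp only [C_add, C_mul, C_sub, C_1, C_ofNat, Nat.reduceAdd, add_assoc] at hq hgn ht ⊢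
      linear_combination (-(C (n : ℂ) + 3) * C (γ (n + 4)) * (1 - C (θ (n + 3)))) * hq
        + C (γ (n + 4)) * (1 - C (θ (n + 3))) * Q n * hgn
        + C (γ (n + 4)) * (C (n : ℂ) + 1) * C (γ (n + 2)) * Q n * ht
  have h := hD n
  have hgn := hg n
  rw [hP] at h
  simp only [C_add, C_mul, C_sub, C_1, C_ofNat] at h hgn ⊢
  linear_combination (C (n : ℂ) + 3) * h + (C (n : ℂ) + 4) * Q n * hgn

/-- the γ-recurrence coefficients satisfy the Hahn-classical
rational recursion iff the monic derivatives are again a threefold symmetric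
three-term sequence with the indicated coefficients. -/
theorem hahn_classical_gamma_characterization
    (ϑ₁ ϑ₂ : ℂ)
    (h1 : ∀ k : ℕ, 1 ≤ k → ϑ₁ ≠ ((k : ℂ) - 1) / k)
    (h2 : ∀ k : ℕ, 1 ≤ k → ϑ₂ ≠ ((k : ℂ) - 1) / k)
    (θ : ℕ → ℂ)
    (hθodd : ∀ n : ℕ, θ (2 * n + 1) =
      (((n : ℂ) + 1) * ϑ₁ - (n : ℂ)) / ((n : ℂ) * ϑ₁ - ((n : ℂ) - 1)))
    (hθeven : ∀ n : ℕ, θ (2 * n + 2) =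
      (((n : ℂ) + 1) * ϑ₂ - (n : ℂ)) / ((n : ℂ) * ϑ₂ - ((n : ℂ) - 1)))
    (γ : ℕ → ℂ) (hγ : ∀ n : ℕ, 1 ≤ n → γ n ≠ 0)
    (P : ℕ → Polynomial ℂ)
    (hP0 : P 0 = 1) (hP1 : P 1 = X) (hP2 : P 2 = X ^ 2)
    (hPrec : ∀ n : ℕ, P (n + 3) = X * P (n + 2) - C (γ (n + 1)) * P n)
    (Q : ℕ → Polynomial ℂ)
    (hQdef : ∀ n : ℕ, Q n = C (((n : ℂ) + 1)⁻¹) * derivative (P (n + 1))) :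
    (∀ n : ℕ, ((n : ℂ) + 1) * (((n : ℂ) + 4) * (θ (n + 1) - 1) + 1) * γ (n + 2) =
        ((n : ℂ) + 3) * ((n : ℂ) * (θ n - 1) + 1) * γ (n + 1)) ↔
      (∀ n : ℕ, Q (n + 3) = X * Q (n + 2)
          - C ((((n : ℂ) + 1) / ((n : ℂ) + 3)) * θ (n + 1) * γ (n + 2)) * Q n) := by
  have hθ (n : ℕ) : (1 - θ (n + 3)) * θ (n + 1) = 1 - θ (n + 1) := by
    obtain ⟨m, rfl | rfl⟩ := n.even_or_odd'
    · rw [show 2 * m + 3 = 2 * (m + 1) + 1 by ring, hθodd, hθodd]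
      exact one_sub_theta_succ_mul_theta h1 m
    · rw [show 2 * m + 1 + 3 = 2 * (m + 1) + 2 by ring, show 2 * m + 1 + 1 = 2 * m + 2 by ring,
        hθeven, hθeven]
      exact one_sub_theta_succ_mul_theta h2 m
  have hQne (n : ℕ) : Q n ≠ 0 := by
    rw [hQdef]
    refine mul_ne_zero (C_ne_zero.2 (inv_ne_zero (Nat.cast_add_one_ne_zero n))) fun h => ?_
    have hdeg := natDegree_eq_of_degree_eq_some
      (degree_of_threefold_symmetric_recurrence hP0 hP1 hP2 hPrec (n + 1))
    have := derivative_eq_zero.1 h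
    omega
  have key := recurrence_defect hθ hP0 hP1 hP2 hPrec hQdef
  constructor
  · intro hi n
    induction n using Nat.strong_induction_on with
    | _ n ih =>
      have h := key n ih
      rw [sub_eq_zero.2 (hi n), C_0, zero_mul, mul_eq_zero, C_eq_zero] at h
      refine sub_eq_zero.1 (h.resolve_left ?_)
      exact_mod_cast (by positivity : (n + 3) * (n + 4) ≠ 0)
  · intro hii n
    have h := key n fun k _ => hii k
    rw [sub_eq_zero.2 (hii n), mul_zero, eq_comm, mul_eq_zero, C_eq_zero] at h
    exact sub_eq_zero.1 (h.resolve_right (hQne n))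
end

section
/- Let ϑ₁, ϑ₂ ∈ ℂ with ϑ₁ ≠ (k−1)/k and ϑ₂ ≠ (k−1)/k for every integer k ≥ 1, and define ϑ_n for n ≥ 1 by the ϑ-recursion. Let γ₁ ∈ ℂ∖{0} and let (γ_n)_{n≥1} satisfy (n+1)·((n+4)(ϑ_{n+1} − 1) + 1)·γ_{n+2} = (n+3)·(n(ϑ_n − 1) + 1)·γ_{n+1} for all n ≥ 0 (the factor n(ϑ_n − 1) + 1 being 1 at n = 0); then all γ_n are nonzero. Let P_n be the monic polynomials defined by the threefold symmetric recurrence. Then for every n ≥ 1 the polynomial P_n satisfies the third-order differential equation (a_n X³ − b_n)·P_n‴ + c_n X²·P_n″ + d_n X·P_n′ = e_n·P_n, where a_n = (ϑ_n − 1)(ϑ_{n+1} − 1), b_n = γ_n·((n−1)ϑ_{n−1} − n + 2)·(nϑ_n − n + 1)·((n+1)ϑ_{n+1} − n)/(n(n+1)) (with the convention that the factor (n−1)ϑ_{n−1} − n + 2 equals 1 when n = 1), c_n = ϑ_nϑ_{n+1} − 1 − (n−3)(ϑ_n − 1)(ϑ_{n+1} − 1), d_n = nϑ_{n+1} − (n−1)ϑ_n(2ϑ_{n+1}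 − 1), and e_n = nϑ_{n+1}. -/
open Polynomial

section Coefficients

theorem coeff_X_mul_derivative (p : ℂ[X]) (k : ℕ) :
    (X * derivative p).coeff k = k * p.coeff k := by
  rcases k with _ | k
  · simp
  · rw [coeff_X_mul, coeff_derivative]
    push_cast
    ring

theorem coeff_X_sq_mul_derivative_two (p : ℂ[X]) (k : ℕ) :
    (X ^ 2 * derivative (derivative p)).coeff k = k * (k - 1) * p.coeff k := by
  rcases k with _ | _ | k
  · simp
  · simp [pow_two, mul_assoc]
  · rw [coeff_X_pow_mul, coeff_derivative, coeff_derivative]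
    push_cast
    ring

theorem coeff_X_cube_mul_derivative_three (p : ℂ[X]) (k : ℕ) :
    (X ^ 3 * derivative (derivative (derivative p))).coeff k =
      k * (k - 1) * (k - 2) * p.coeff k := by
  rcases k with _ | _ | _ | k
  · simp
  · simp [pow_succ, mul_assoc]
  · simp [coeff_X_pow_mul']
  · rw [coeff_X_pow_mul, coeff_derivative, coeff_derivative, coeff_derivative]
    push_cast
    ring

theorem coeff_derivative_three (p : ℂ[X]) (k : ℕ) :
    (derivative (derivative (derivative p))).coeff k =
      (k + 1) * (k + 2) * (k + 3) * p.coeff (k + 3) := by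
  rw [coeff_derivative, coeff_derivative, coeff_derivative]
  push_cast
  ring

/-- A third order equation of this shape is a two-term recurrence for the coefficients. -/
theorem third_order_ode_of_coeff (p : ℂ[X]) (a b c d e : ℂ)
    (h : ∀ k : ℕ, (a * (k * (k - 1) * (k - 2)) + c * (k * (k - 1)) + d * k - e) * p.coeff k =
      b * ((k + 1) * (k + 2) * (k + 3)) * p.coeff (k + 3)) :
    (C a * X ^ 3 - C b) * derivative (derivative (derivative p))
      + C c * X ^ 2 * derivative (derivative p) + C d * X * derivative p = C e * p := by
  ext k
  rw [sub_mul, mul_assoc (C a), mul_assoc (C c), mul_assoc (C d)]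
  simp only [coeff_add, coeff_sub, coeff_C_mul, coeff_X_cube_mul_derivative_three,
    coeff_X_sq_mul_derivative_two, coeff_X_mul_derivative, coeff_derivative_three]
  linear_combination h k

end Coefficients

/-- Linear data behind the `ϑ`-recursion: `ϑ_n - 1 = σ_n / D_n`, where `σ` is 2-periodic and `D`
is an arithmetic progression along each parity class. -/
structure ThetaData (σ D : ℕ → ℂ) : Prop where
  D_zero : D 0 = 1
  σ_add_two : ∀ n, 1 ≤ n → σ (n + 2) = σ n
  D_add_two : ∀ n, 1 ≤ n → D (n + 2) = D n + σ n
  D_ne_zero : ∀ n, D n ≠ 0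
  H_ne_zero : ∀ n : ℕ, D n + n * σ n ≠ 0

theorem natCast_mul_sub_one_add_one_ne_zero {z : ℂ}
    (h : ∀ k : ℕ, 1 ≤ k → z ≠ ((k : ℂ) - 1) / k) (k : ℕ) : (k : ℂ) * (z - 1) + 1 ≠ 0 := by
  rcases k.eq_zero_or_pos with rfl | hk
  · simp
  · intro h0
    have hk' : (k : ℂ) ≠ 0 := Nat.cast_ne_zero.mpr hk.ne'
    refine h k hk ?_
    rw [eq_div_iff hk']
    linear_combination h0

theorem exists_thetaData (ϑ₁ ϑ₂ : ℂ)
    (h1 : ∀ k : ℕ, 1 ≤ k → ϑ₁ ≠ ((k : ℂ) - 1) / k)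
    (h2 : ∀ k : ℕ, 1 ≤ k → ϑ₂ ≠ ((k : ℂ) - 1) / k)
    (θ : ℕ → ℂ)
    (hθodd : ∀ n : ℕ, θ (2 * n + 1) =
      (((n : ℂ) + 1) * ϑ₁ - (n : ℂ)) / ((n : ℂ) * ϑ₁ - ((n : ℂ) - 1)))
    (hθeven : ∀ n : ℕ, θ (2 * n + 2) =
      (((n : ℂ) + 1) * ϑ₂ - (n : ℂ)) / ((n : ℂ) * ϑ₂ - ((n : ℂ) - 1))) :
    ∃ σ D : ℕ → ℂ, ThetaData σ D ∧ ∀ n, 1 ≤ n → θ n = 1 + σ n / D n := by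
  let σ : ℕ → ℂ := fun n => if n = 0 then 0 else if Even n then ϑ₂ - 1 else ϑ₁ - 1
  let D : ℕ → ℂ := fun n => ((n - 1) / 2 : ℕ) * σ n + 1
  have h1' := natCast_mul_sub_one_add_one_ne_zero h1
  have h2' := natCast_mul_sub_one_add_one_ne_zero h2
  have cases3 : ∀ n : ℕ, n = 0 ∨ (∃ m, n = 2 * m + 1) ∨ ∃ m, n = 2 * m + 2 := by
    intro n
    rcases n.eq_zero_or_pos with h | h
    · exact Or.inl h
    · rcases Nat.even_or_odd' n with ⟨m, h' | h'⟩
      · exact Or.inr (Or.inr ⟨m - 1, by omega⟩)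
      · exact Or.inr (Or.inl ⟨m, h'⟩)
  have σodd : ∀ m, σ (2 * m + 1) = ϑ₁ - 1 := fun m => by simp [σ]
  have σeven : ∀ m, σ (2 * m + 2) = ϑ₂ - 1 := fun m => by simp [σ, parity_simps]
  have Dodd : ∀ m : ℕ, D (2 * m + 1) = m * (ϑ₁ - 1) + 1 := fun m => by
    have : (2 * m + 1 - 1) / 2 = m := by omega
    simp only [D, this, σodd]
  have Deven : ∀ m : ℕ, D (2 * m + 2) = m * (ϑ₂ - 1) + 1 := fun m => by
    have : (2 * m + 2 - 1) / 2 = m := by omega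
    simp only [D, this, σeven]
  refine ⟨σ, D, ⟨by simp [D, σ], ?_, ?_, ?_, ?_⟩, ?_⟩
  · intro n hn
    rcases cases3 n with rfl | ⟨m, rfl⟩ | ⟨m, rfl⟩
    · omega
    · rw [show 2 * m + 1 + 2 = 2 * (m + 1) + 1 by ring, σodd, σodd]
    · rw [show 2 * m + 2 + 2 = 2 * (m + 1) + 2 by ring, σeven, σeven]
  · intro n hn
    rcases cases3 n with rfl | ⟨m, rfl⟩ | ⟨m, rfl⟩
    · omega
    · rw [show 2 * m + 1 + 2 = 2 * (m + 1) + 1 by ring, Dodd, Dodd, σodd]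
      push_cast
      ring
    · rw [show 2 * m + 2 + 2 = 2 * (m + 1) + 2 by ring, Deven, Deven, σeven]
      push_cast
      ring
  · intro n
    rcases cases3 n with rfl | ⟨m, rfl⟩ | ⟨m, rfl⟩
    · simp [D]
    · rw [Dodd]
      exact h1' m
    · rw [Deven]
      exact h2' m
  · intro n
    rcases cases3 n with rfl | ⟨m, rfl⟩ | ⟨m, rfl⟩
    · simp [D]
    · rw [Dodd, σodd]
      convert h1' (3 * m + 1) using 1
      push_cast
      ring
    · rw [Deven, σeven]
      convert h2' (3 * m + 2) using 1
      push_cast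
      ring
  · intro n hn
    rcases cases3 n with rfl | ⟨m, rfl⟩ | ⟨m, rfl⟩
    · omega
    · have h := h1' m
      rw [hθodd, Dodd, σodd,
        show (m : ℂ) * ϑ₁ - ((m : ℂ) - 1) = m * (ϑ₁ - 1) + 1 by ring]
      field_simp
      ring
    · have h := h2' m
      rw [hθeven, Deven, σeven,
        show (m : ℂ) * ϑ₂ - ((m : ℂ) - 1) = m * (ϑ₂ - 1) + 1 by ring]
      field_simp
      ring

namespace ThetaData

variable {σ D : ℕ → ℂ}

theorem σ_add_two_mul (hd : ThetaData σ D) {m : ℕ} (hm : 1 ≤ m) (j : ℕ) :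
    σ (m + 2 * j) = σ m := by
  induction j with
  | zero => simp
  | succ j ih =>
    rw [show m + 2 * (j + 1) = m + 2 * j + 2 by ring, hd.σ_add_two _ (by omega), ih]

theorem D_add_two_mul (hd : ThetaData σ D) {m : ℕ} (hm : 1 ≤ m) (j : ℕ) :
    D (m + 2 * j) = D m + j * σ m := by
  induction j with
  | zero => simp
  | succ j ih =>
    rw [show m + 2 * (j + 1) = m + 2 * j + 2 by ring, hd.D_add_two _ (by omega), ih,
      hd.σ_add_two_mul hm]
    push_cast
    ring

end ThetaData

/-- The product of the consecutive values `D_i + i σ_i` for `a ≤ i < a + m`. -/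
noncomputable def hProd (σ D : ℕ → ℂ) (a m : ℕ) : ℂ :=
  ∏ i ∈ Finset.range m, (D (a + i) + (a + i : ℕ) * σ (a + i))

/-- The coefficient of `X ^ k` in the polynomial of index `k + 3 * j`. -/
noncomputable def hahnCoeff (σ D : ℕ → ℂ) (β : ℂ) (k j : ℕ) : ℂ :=
  (-β / 3) ^ j * (k + 3 * j).factorial / (j.factorial * k.factorial * hProd σ D (k + j) (2 * j))

section HahnCoeff

variable {σ D : ℕ → ℂ}

theorem hProd_succ (a m : ℕ) :
    hProd σ D a (m + 1) = hProd σ D a m * (D (a + m) + (a + m : ℕ) * σ (a + m)) :=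
  Finset.prod_range_succ _ _

theorem hProd_succ' (a m : ℕ) :
    hProd σ D a (m + 1) = (D a + a * σ a) * hProd σ D (a + 1) m := by
  simp only [hProd]
  rw [Finset.prod_range_succ', mul_comm]
  simp only [Nat.add_zero]
  congr 1
  refine Finset.prod_congr rfl fun i _ => ?_
  rw [show a + (i + 1) = a + 1 + i by ring]

theorem hProd_ne_zero (hd : ThetaData σ D) (a m : ℕ) : hProd σ D a m ≠ 0 :=
  Finset.prod_ne_zero_iff.mpr fun i _ => hd.H_ne_zero (a + i)

theorem hahnCoeff_zero (β : ℂ) (k : ℕ) : hahnCoeff σ D β k 0 = 1 := by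
  have : (k.factorial : ℂ) ≠ 0 := Nat.cast_ne_zero.mpr k.factorial_ne_zero
  simp [hahnCoeff, hProd, this]

theorem hahnCoeff_succ (hd : ThetaData σ D) (β : ℂ) (k j : ℕ) :
    3 * (j + 1) * (D (k + j + 1) + (k + j + 1 : ℕ) * σ (k + j + 1)) *
        (D (k + j + 2) + (k + j + 2 : ℕ) * σ (k + j + 2)) * hahnCoeff σ D β k (j + 1) =
      -β * ((k + 1) * (k + 2) * (k + 3)) * hahnCoeff σ D β (k + 3) j := by
  have hg := hProd_ne_zero hd (k + j + 3) (2 * j)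
  have hA := hd.H_ne_zero (k + j + 1)
  have hB := hd.H_ne_zero (k + j + 2)
  have hj : (j.factorial : ℂ) ≠ 0 := Nat.cast_ne_zero.mpr j.factorial_ne_zero
  have hk : (k.factorial : ℂ) ≠ 0 := Nat.cast_ne_zero.mpr k.factorial_ne_zero
  have hj1 : (j + 1 : ℂ) ≠ 0 := Nat.cast_add_one_ne_zero j
  have hk1 : (k + 1 : ℂ) ≠ 0 := Nat.cast_add_one_ne_zero k
  have hk2 : (k + 1 + 1 : ℂ) ≠ 0 := by exact_mod_cast (k + 1).succ_ne_zero
  have hk3 : (k + 2 + 1 : ℂ) ≠ 0 := by exact_mod_cast (k + 2).succ_ne_zero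
  simp only [hahnCoeff]
  rw [show 2 * (j + 1) = 2 * j + 1 + 1 by ring, hProd_succ', hProd_succ',
    show k + (j + 1) = k + j + 1 by ring, show k + j + 1 + 1 = k + j + 2 by ring,
    show k + j + 2 + 1 = k + j + 3 by ring, show k + 3 + j = k + j + 3 by ring,
    show k + 3 * (j + 1) = k + 3 + 3 * j by ring, Nat.factorial_succ j,
    Nat.factorial_succ (k + 2), Nat.factorial_succ (k + 1), Nat.factorial_succ k]
  generalize hProd σ D (k + j + 3) (2 * j) = g at *
  generalize D (k + j + 1) + (k + j + 1 : ℕ) * σ (k + j + 1) = A at *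
  generalize D (k + j + 2) + (k + j + 2 : ℕ) * σ (k + j + 2) = B at *
  push_cast
  field_simp
  ring

variable {γ : ℕ → ℂ} {β : ℂ}

theorem hahnCoeff_zero_succ (hd : ThetaData σ D)
    (hγ : ∀ n : ℕ, γ (n + 1) * hProd σ D n 3 = β * ((n + 1) * (n + 2)) * D n) (j : ℕ) :
    hahnCoeff σ D β 0 (j + 1) = -γ (3 * j + 1) * hahnCoeff σ D β 0 j := by
  have hD : D (3 * j) = D j + j * σ j := by
    rcases j.eq_zero_or_pos with rfl | hj
    · simp
    · rw [show 3 * j = j + 2 * j by ring, hd.D_add_two_mul hj]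
  have hprod : hProd σ D j (2 * j) * hProd σ D (3 * j) 3 =
      (D j + j * σ j) * hProd σ D (j + 1) (2 * j + 2) := by
    rw [← hProd_succ', hProd_succ, hProd_succ, hProd_succ, hProd_succ, hProd_succ, hProd_succ,
      show j + 2 * j = 3 * j + 0 by ring, show j + (2 * j + 1) = 3 * j + 1 by ring,
      show j + (2 * j + 2) = 3 * j + 2 by ring]
    simp [hProd, mul_assoc]
  have hγj := hγ (3 * j)
  rw [hD] at hγj
  have hA := hd.H_ne_zero j
  have hg := hProd_ne_zero hd j (2 * j)
  have hg' := hProd_ne_zero hd (j + 1) (2 * j + 2)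
  have hh := hProd_ne_zero hd (3 * j) 3
  have hj : (j.factorial : ℂ) ≠ 0 := Nat.cast_ne_zero.mpr j.factorial_ne_zero
  have hj1 : (j + 1 : ℂ) ≠ 0 := Nat.cast_add_one_ne_zero j
  have hγ' := eq_div_of_mul_eq hh hγj
  rw [hγ']
  have hh' := eq_div_of_mul_eq hg ((mul_comm _ _).trans hprod)
  rw [hh']
  simp only [hahnCoeff, Nat.zero_add]
  rw [show 2 * (j + 1) = 2 * j + 2 by ring, show 3 * (j + 1) = 3 * j + 2 + 1 by ring,
    Nat.factorial_succ j, Nat.factorial_succ, Nat.factorial_succ, Nat.factorial_succ]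
  generalize hProd σ D j (2 * j) = g at *
  generalize hProd σ D (j + 1) (2 * j + 2) = g' at *
  generalize D j + j * σ j = A at *
  push_cast
  field_simp
  ring

theorem hahnCoeff_succ_succ (hd : ThetaData σ D)
    (hγ : ∀ n : ℕ, γ (n + 1) * hProd σ D n 3 = β * ((n + 1) * (n + 2)) * D n) (k j : ℕ) :
    hahnCoeff σ D β (k + 1) (j + 1) =
      hahnCoeff σ D β k (j + 1) - γ (k + 3 * j + 2) * hahnCoeff σ D β (k + 1) j := by
  obtain ⟨a, ha⟩ : ∃ a, a = k + j + 1 := ⟨_, rfl⟩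
  have ha1 : 1 ≤ a := by omega
  have hγn := hγ (a + 2 * j)
  have hthree : hProd σ D (a + 2 * j) 3 = hProd σ D (a + 2 * j) 2 *
      (D a + a * σ a + 3 * (j + 1) * σ a) := by
    rw [hProd_succ, show a + 2 * j + 2 = a + 2 * (j + 1) by ring, hd.D_add_two_mul ha1,
      hd.σ_add_two_mul ha1]
    push_cast
    ring
  have hsplit : hProd σ D a (2 * j + 2) = hProd σ D a (2 * j) * hProd σ D (a + 2 * j) 2 := by
    rw [hProd_succ, hProd_succ, hProd_succ, hProd_succ, ← add_assoc]
    simp [hProd, mul_assoc]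
  have hprod : hProd σ D a (2 * j + 2) * (D a + a * σ a + 3 * (j + 1) * σ a) =
      (D a + a * σ a) * hProd σ D (a + 1) (2 * j + 2) := by
    rw [← hProd_succ', hProd_succ _ (2 * j + 2), show a + (2 * j + 2) = a + 2 * (j + 1) by ring,
      hd.D_add_two_mul ha1, hd.σ_add_two_mul ha1]
    push_cast
    ring
  rw [hthree, hd.D_add_two_mul ha1] at hγn
  have hA := hd.H_ne_zero a
  have hg := hProd_ne_zero hd a (2 * j)
  have hh := hProd_ne_zero hd (a + 2 * j) 2
  have hg' := hProd_ne_zero hd (a + 1) (2 * j + 2)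
  have hB : D a + a * σ a + 3 * (j + 1) * σ a ≠ 0 := by
    intro h
    rw [h, mul_zero] at hprod
    exact mul_ne_zero hA hg' hprod.symm
  have hj : (j.factorial : ℂ) ≠ 0 := Nat.cast_ne_zero.mpr j.factorial_ne_zero
  have hj1 : (j + 1 : ℂ) ≠ 0 := Nat.cast_add_one_ne_zero j
  have hk : (k.factorial : ℂ) ≠ 0 := Nat.cast_ne_zero.mpr k.factorial_ne_zero
  have hk1 : (k + 1 : ℂ) ≠ 0 := Nat.cast_add_one_ne_zero k
  have hγ' := eq_div_of_mul_eq (mul_ne_zero hh hB) hγn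
  have hg'' := eq_div_of_mul_eq hA ((mul_comm _ _).trans hprod.symm)
  simp only [hahnCoeff]
  rw [show k + 3 * j + 2 = a + 2 * j + 1 by omega, hγ',
    show k + 1 + (j + 1) = a + 1 by omega, show k + (j + 1) = a by omega,
    show k + 1 + j = a by omega, show 2 * (j + 1) = 2 * j + 2 by ring, hg'', hsplit,
    show k + 1 + 3 * (j + 1) = k + 3 * j + 1 + 1 + 1 + 1 by ring,
    show k + 3 * (j + 1) = k + 3 * j + 1 + 1 + 1 by ring,
    show k + 1 + 3 * j = k + 3 * j + 1 by ring,
    Nat.factorial_succ (k + 3 * j + 1 + 1 + 1), Nat.factorial_succ (k + 3 * j + 1 + 1),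
    Nat.factorial_succ (k + 3 * j + 1), Nat.factorial_succ j, Nat.factorial_succ k]
  have haC : (a : ℂ) = k + j + 1 := by rw [ha]; push_cast; ring
  rw [show D a + (j : ℂ) * σ a = (D a + a * σ a) - a * σ a + j * σ a by ring]
  generalize hProd σ D a (2 * j) = g at *
  generalize hProd σ D (a + 2 * j) 2 = h at *
  generalize D a + a * σ a = A at *
  push_cast
  rw [haC]
  field_simp
  ring

theorem coeff_eq_hahnCoeff (hd : ThetaData σ D)
    (hγ : ∀ n : ℕ, γ (n + 1) * hProd σ D n 3 = β * ((n + 1) * (n + 2)) * D n)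
    {P : ℕ → ℂ[X]} (hP0 : P 0 = 1) (hP1 : P 1 = X) (hP2 : P 2 = X ^ 2)
    (hPrec : ∀ n : ℕ, P (n + 3) = X * P (n + 2) - C (γ (n + 1)) * P n) (n : ℕ) :
    (∀ k j, n = k + 3 * j → (P n).coeff k = hahnCoeff σ D β k j) ∧
      ∀ k, (∀ j, n ≠ k + 3 * j) → (P n).coeff k = 0 := by
  have base : ∀ m, m < 3 → P m = X ^ m →
      (∀ k j, m = k + 3 * j → (P m).coeff k = hahnCoeff σ D β k j) ∧
        ∀ k, (∀ j, m ≠ k + 3 * j) → (P m).coeff k = 0 := by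
    intro m hm hPm
    refine ⟨fun k j h => ?_, fun k h => ?_⟩
    · obtain rfl : j = 0 := by omega
      obtain rfl : m = k := by omega
      rw [hPm, hahnCoeff_zero, coeff_X_pow_self]
    · rw [hPm, coeff_X_pow, if_neg]
      rintro rfl
      exact h 0 rfl
  induction n using Nat.strong_induction_on with
  | _ n ih =>
    match n, ih with
    | 0, _ => exact base 0 (by norm_num) (by rw [hP0, pow_zero])
    | 1, _ => exact base 1 (by norm_num) (by rw [hP1, pow_one])
    | 2, _ => exact base 2 (by norm_num) hP2
    | n + 3, ih =>
      obtain ⟨ih0, ih0'⟩ := ih n (by omega)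
      obtain ⟨ih2, ih2'⟩ := ih (n + 2) (by omega)
      rw [hPrec]
      refine ⟨fun k j h => ?_, fun k h => ?_⟩
      · rw [coeff_sub, coeff_C_mul]
        rcases k with _ | k <;> rcases j with _ | j
        · omega
        · rw [coeff_X_mul_zero, ih0 0 j (by omega), hahnCoeff_zero_succ hd hγ,
            show n + 1 = 3 * j + 1 by omega]
          ring
        · rw [coeff_X_mul, ih2 k 0 (by omega), ih0' (k + 1) (fun j => by omega),
            hahnCoeff_zero, hahnCoeff_zero]
          ring
        · rw [coeff_X_mul, ih2 k (j + 1) (by omega), ih0 (k + 1) j (by omega),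
            hahnCoeff_succ_succ hd hγ, show n + 1 = k + 3 * j + 2 by omega]
      · rw [coeff_sub, coeff_C_mul, ih0' k (fun j hj => h (j + 1) (by omega))]
        rcases k with _ | k
        · simp
        · rw [coeff_X_mul, ih2' k (fun j hj => h j (by omega))]
          simp

end HahnCoeff

/-- threefold symmetric Hahn-classical 2-orthogonal polynomials
satisfy a third order differential equation of Bochner type. -/
theorem hahn_classical_third_order_ode
    (ϑ₁ ϑ₂ : ℂ)
    (h1 : ∀ k : ℕ, 1 ≤ k → ϑ₁ ≠ ((k : ℂ) - 1) / k)
    (h2 : ∀ k : ℕ, 1 ≤ k → ϑ₂ ≠ ((k : ℂ) - 1) / k)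
    (θ : ℕ → ℂ)
    (hθodd : ∀ n : ℕ, θ (2 * n + 1) =
      (((n : ℂ) + 1) * ϑ₁ - (n : ℂ)) / ((n : ℂ) * ϑ₁ - ((n : ℂ) - 1)))
    (hθeven : ∀ n : ℕ, θ (2 * n + 2) =
      (((n : ℂ) + 1) * ϑ₂ - (n : ℂ)) / ((n : ℂ) * ϑ₂ - ((n : ℂ) - 1)))
    (γ : ℕ → ℂ) (hγ₁ : γ 1 ≠ 0)
    (hγrec : ∀ n : ℕ, ((n : ℂ) + 1) * (((n : ℂ) + 4) * (θ (n + 1) - 1) + 1) * γ (n + 2) =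
        ((n : ℂ) + 3) * ((n : ℂ) * (θ n - 1) + 1) * γ (n + 1))
    (P : ℕ → Polynomial ℂ)
    (hP0 : P 0 = 1) (hP1 : P 1 = X) (hP2 : P 2 = X ^ 2)
    (hPrec : ∀ n : ℕ, P (n + 3) = X * P (n + 2) - C (γ (n + 1)) * P n) :
    (∀ n : ℕ, 1 ≤ n → γ n ≠ 0) ∧
    (∀ n : ℕ, 1 ≤ n →
      (C ((θ n - 1) * (θ (n + 1) - 1)) * X ^ 3
          - C (γ n * (((n : ℂ) - 1) * θ (n - 1) - (n : ℂ) + 2) *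
               ((n : ℂ) * θ n - (n : ℂ) + 1) * (((n : ℂ) + 1) * θ (n + 1) - (n : ℂ)) /
               ((n : ℂ) * ((n : ℂ) + 1))))
        * derivative (derivative (derivative (P n)))
      + C (θ n * θ (n + 1) - 1 - ((n : ℂ) - 3) * (θ n - 1) * (θ (n + 1) - 1)) * X ^ 2
        * derivative (derivative (P n))
      + C ((n : ℂ) * θ (n + 1) - ((n : ℂ) - 1) * θ n * (2 * θ (n + 1) - 1)) * X
        * derivative (P n)
      = C ((n : ℂ) * θ (n + 1)) * P n) := by
  obtain ⟨σ, D, hd, hθ⟩ := exists_thetaData ϑ₁ ϑ₂ h1 h2 θ hθodd hθeven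
  have hfac : ∀ n : ℕ, (n : ℂ) * (θ n - 1) + 1 = (D n + n * σ n) / D n := by
    intro n
    have hDn := hd.D_ne_zero n
    rcases n.eq_zero_or_pos with rfl | hn
    · simp [hDn]
    · rw [hθ n hn]
      field_simp
      ring
  have hthree : ∀ n : ℕ, hProd σ D n 3 = (D n + n * σ n) *
      (D (n + 1) + (n + 1 : ℕ) * σ (n + 1)) * (D (n + 2) + (n + 2 : ℕ) * σ (n + 2)) := by
    intro n
    simp [hProd, Finset.prod_range_succ]
  obtain ⟨β, hβ⟩ : ∃ β, β = γ 1 * hProd σ D 0 3 / 2 := ⟨_, rfl⟩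
  have hβ0 : β ≠ 0 := by
    rw [hβ]
    exact div_ne_zero (mul_ne_zero hγ₁ (hProd_ne_zero hd 0 3)) two_ne_zero
  have hγ : ∀ n : ℕ, γ (n + 1) * hProd σ D n 3 = β * ((n + 1) * (n + 2)) * D n := by
    intro n
    induction n with
    | zero =>
      rw [hβ, hd.D_zero]
      push_cast
      ring
    | succ n ih =>
      have hDn := hd.D_ne_zero n
      have hDn1 := hd.D_ne_zero (n + 1)
      have hHn := hd.H_ne_zero n
      have hn1 : (n + 1 : ℂ) ≠ 0 := Nat.cast_add_one_ne_zero n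
      have hr := hγrec n
      rw [hfac, hθ (n + 1) (by omega)] at hr
      have hH3 : D (n + 3) + (n + 3 : ℕ) * σ (n + 3) = D (n + 1) + (n + 4) * σ (n + 1) := by
        rw [show n + 3 = n + 1 + 2 by ring, hd.D_add_two _ (by omega), hd.σ_add_two _ (by omega)]
        push_cast
        ring
      have hr' : (n + 1) * (D (n + 1) + (n + 4) * σ (n + 1)) * D n * γ (n + 2) =
          (n + 3) * (D n + n * σ n) * D (n + 1) * γ (n + 1) := by
        field_simp at hr
        linear_combination hr
      rw [hthree] at ih ⊢
      rw [show n + 1 + 1 = n + 2 by ring, show n + 1 + 2 = n + 3 by ring, hH3]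
      apply mul_left_cancel₀ (mul_ne_zero hn1 hDn)
      generalize D (n + 1) + (n + 1 : ℕ) * σ (n + 1) = B at *
      generalize D (n + 2) + (n + 2 : ℕ) * σ (n + 2) = E at *
      push_cast
      linear_combination B * E * hr' + (n + 3) * D (n + 1) * ih
  refine ⟨fun n hn h0 => ?_, fun n hn => third_order_ode_of_coeff _ _ _ _ _ _ fun k => ?_⟩
  · obtain ⟨m, rfl⟩ := Nat.exists_eq_add_of_le' hn
    have h := hγ m
    rw [h0, zero_mul] at h
    have hm1 : (m + 1 : ℂ) ≠ 0 := Nat.cast_add_one_ne_zero m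
    have hm2 : (m + 2 : ℂ) ≠ 0 := by exact_mod_cast (m + 1).succ_ne_zero
    exact mul_ne_zero (mul_ne_zero hβ0 (mul_ne_zero hm1 hm2)) (hd.D_ne_zero m) h.symm
  · obtain ⟨hcoeff, hcoeff0⟩ := coeff_eq_hahnCoeff hd hγ hP0 hP1 hP2 hPrec n
    by_cases hk : ∃ j, n = k + 3 * j
    · obtain ⟨j, hj⟩ := hk
      rw [hcoeff k j hj]
      rcases j with _ | j
      · obtain rfl : n = k := by omega
        rw [hcoeff0 (n + 3) (fun j => by omega)]
        ring
      · rw [hcoeff (k + 3) j (by omega)]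
        have hb : γ n * (((n : ℂ) - 1) * θ (n - 1) - (n : ℂ) + 2) *
            ((n : ℂ) * θ n - (n : ℂ) + 1) * (((n : ℂ) + 1) * θ (n + 1) - (n : ℂ)) /
            ((n : ℂ) * ((n : ℂ) + 1)) = β / (D n * D (n + 1)) := by
          obtain ⟨m, rfl⟩ := Nat.exists_eq_add_of_le' hn
          have hm := hfac m
          have hm1 := hfac (m + 1)
          have hm2 := hfac (m + 2)
          have hDm := hd.D_ne_zero m
          have hDm1 := hd.D_ne_zero (m + 1)
          have hDm2 := hd.D_ne_zero (m + 2)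
          have hc1 : (m + 1 : ℂ) ≠ 0 := Nat.cast_add_one_ne_zero m
          have hc2 : (m + 1 + 1 : ℂ) ≠ 0 := by exact_mod_cast (m + 1).succ_ne_zero
          have h := hγ m
          rw [hthree] at h
          rw [Nat.add_sub_cancel, show m + 1 + 1 = m + 2 by ring,
            show ((m + 1 : ℕ) - 1 : ℂ) * θ m - (m + 1 : ℕ) + 2 = m * (θ m - 1) + 1 by
              push_cast; ring,
            show ((m + 1 : ℕ) : ℂ) * θ (m + 1) - (m + 1 : ℕ) + 1 =
              (m + 1 : ℕ) * (θ (m + 1) - 1) + 1 by ring,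
            show ((m + 1 : ℕ) + 1 : ℂ) * θ (m + 2) - (m + 1 : ℕ) =
              (m + 2 : ℕ) * (θ (m + 2) - 1) + 1 by push_cast; ring, hm, hm1, hm2]
          generalize D m + m * σ m = A at *
          generalize D (m + 1) + (m + 1 : ℕ) * σ (m + 1) = B at *
          generalize D (m + 2) + (m + 2 : ℕ) * σ (m + 2) = E at *
          push_cast
          field_simp
          linear_combination h
        have hDn := hd.D_ne_zero n
        have hDn1 := hd.D_ne_zero (n + 1)
        have hs := hahnCoeff_succ hd β k j
        have hA : D (k + j + 1) + (k + j + 1 : ℕ) * σ (k + j + 1) = D n + k * σ n := by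
          rw [show n = k + j + 1 + 2 * (j + 1) by omega, hd.D_add_two_mul (by omega),
            hd.σ_add_two_mul (by omega)]
          push_cast
          ring
        have hB : D (k + j + 2) + (k + j + 2 : ℕ) * σ (k + j + 2) =
            D (n + 1) + (k + 1) * σ (n + 1) := by
          rw [show n + 1 = k + j + 2 + 2 * (j + 1) by omega, hd.D_add_two_mul (by omega),
            hd.σ_add_two_mul (by omega)]
          push_cast
          ring
        have hnC : (n : ℂ) = k + 3 * (j + 1) := by rw [hj]; push_cast; ring
        rw [hA, hB] at hs
        rw [hb, hθ n hn, hθ (n + 1) (by omega), hnC]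
        generalize hahnCoeff σ D β k (j + 1) = w at *
        generalize hahnCoeff σ D β (k + 3) j = w' at *
        field_simp
        linear_combination -hs
    · push Not at hk
      rw [hcoeff0 k hk, hcoeff0 (k + 3) (fun j hj => hk (j + 1) (by omega)), mul_zero, mul_zero]
end

section
/- Let P_n ∈ ℂ[X] be the monic polynomials defined by P_0 = 1, P_1 = X, P_2 = X², and P_{n+1}(X) = X·P_n(X) − n(n−1)·P_{n−2}(X) for n ≥ 2 (the threefold symmetric recurrence with γ_n = n(n+1)). Then {P_n} is an Appell sequence: P_{n+1}′ = (n+1)·P_n for every n ≥ 0. -/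
open Polynomial

/-- Case A: the threefold symmetric sequence with
γ_n = n(n+1) is an Appell sequence. -/
theorem caseA_appell
    (P : ℕ → Polynomial ℂ)
    (hP0 : P 0 = 1) (hP1 : P 1 = X) (hP2 : P 2 = X ^ 2)
    (hPrec : ∀ n : ℕ, P (n + 3) =
      X * P (n + 2) - C (((n : ℂ) + 2) * ((n : ℂ) + 1)) * P n) :
    ∀ n : ℕ, derivative (P (n + 1)) = C ((n : ℂ) + 1) * P n := by
  intro n
  induction n using Nat.strong_induction_on with
  | _ n ih =>
    match n, ih with
    | 0, _ => simp [hP0, hP1]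
    | 1, _ =>
      rw [hP2, hP1]
      simp only [derivative_X_pow, Nat.cast_one, map_add, map_one]
      norm_num
      exact map_ofNat C 2
    | 2, _ =>
      rw [hPrec 0, hP2, hP0]
      simp only [derivative_sub, derivative_mul, derivative_X, derivative_X_pow, derivative_C,
        derivative_one, map_add, map_one, map_natCast]
      norm_num
      ring
    | k + 3, ih =>
      have h2 := ih (k + 2) (by omega)
      have h0 := ih k (by omega)
      have r := hPrec k
      rw [hPrec (k + 1), derivative_sub, derivative_mul, derivative_mul, derivative_X,
        derivative_C, h2, h0]
      simp only [Nat.cast_add, Nat.cast_one, Nat.cast_ofNat, map_add, map_mul, map_one,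
        map_ofNat, map_natCast] at r ⊢
      linear_combination -((k : ℂ[X]) + 3) * r
end

section
/- Let μ ∈ ℂ with μ + 3k + 2 ≠ 0 for every integer k ≥ 0. Let P_n(·; μ) be the monic polynomials defined by the threefold symmetric recurrence with coefficients γ_{2n+1} = (2/3)·(n+1)(2n+1)/(3n+μ+2) and γ_{2n+2} = (2/3)·(n+1)(2n+3)(n+μ+1)/((3n+μ+2)(3n+μ+5)) for n ≥ 0 (case B₁), and let R_n(·; ρ) be the monic polynomials defined by the threefold symmetric recurrence with coefficients γ_{2n} = 2n(2n+1)/(3(3n+ρ)) for n ≥ 1 and γ_{2n+1} = 2(n+1)(2n+1)(n+ρ)/(3(3n+ρ)(3n+ρ+3)) for n ≥ 0 (case B₂). Then for every n ≥ 0: d/dX P_{n+1}(X; μ) = (n+1)·R_n(X; μ+2). -/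
open Polynomial

section ThreefoldSymmetric

variable {K : Type*} [CommRing K] {a b c : ℕ → K} {P R : ℕ → K[X]}

/-- A connection formula between two threefold symmetric families whose recurrence coefficients
`a`, `b` are linked through a sequence `c`. -/
theorem threefold_symmetric_connection
    (hP0 : P 0 = 1) (hP1 : P 1 = X) (hP2 : P 2 = X ^ 2)
    (hPrec : ∀ n : ℕ, P (n + 3) = X * P (n + 2) - C (a (n + 1)) * P n)
    (hR0 : R 0 = 1) (hR1 : R 1 = X) (hR2 : R 2 = X ^ 2)
    (hRrec : ∀ n : ℕ, R (n + 3) = X * R (n + 2) - C (b (n + 1)) * R n)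
    (hc0 : c 0 = b 1 - a 1) (hc : ∀ n : ℕ, c (n + 1) = c n + b (n + 2) - a (n + 2))
    (hmul : ∀ n : ℕ, c (n + 2) * b (n + 1) = a (n + 4) * c n) (n : ℕ) :
    P (n + 3) = R (n + 3) + C (c n) * R n := by
  have h3 : P 3 = R 3 + C (c 0) * R 0 := by
    rw [hPrec 0, hRrec 0, hP2, hR2, hP0, hR0, hc0, C_sub]
    ring
  have h4 : P 4 = R 4 + C (c 1) * R 1 := by
    rw [hPrec 1, hRrec 1, h3, hP1, hR1, hR0, hc 0, C_sub, C_add]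
    ring
  have h5 : P 5 = R 5 + C (c 2) * R 2 := by
    rw [hPrec 2, hRrec 2, h4, hP2, hR2, hR1, hc 1, C_sub, C_add]
    ring
  induction n using Nat.strong_induction_on with
  | _ n ih =>
    match n with
    | 0 => exact h3
    | 1 => exact h4
    | 2 => exact h5
    | m + 3 =>
      have hCmul := congrArg C (hmul m)
      rw [C_mul, C_mul] at hCmul
      have hrec := hRrec m
      rw [hPrec (m + 3), hRrec (m + 3), ih (m + 2) (by lia), ih m (by lia), hc (m + 2),
        C_sub, C_add]
      linear_combination -C (c (m + 2)) * hrec + R m * hCmul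

/-- If the coefficients of the connection formula have the form forced by differentiating the
recurrence, then the monic derivatives of the family `P` are the family `R`. -/
theorem threefold_symmetric_derivative
    (hP0 : P 0 = 1) (hP1 : P 1 = X) (hP2 : P 2 = X ^ 2)
    (hPrec : ∀ n : ℕ, P (n + 3) = X * P (n + 2) - C (a (n + 1)) * P n)
    (hR0 : R 0 = 1) (hR1 : R 1 = X) (hR2 : R 2 = X ^ 2)
    (hRrec : ∀ n : ℕ, R (n + 3) = X * R (n + 2) - C (b (n + 1)) * R n)
    (hconn : ∀ n : ℕ, P (n + 3) = R (n + 3) + C (c n) * R n)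
    (hc : ∀ n : ℕ, c n = ((n : K) + 1) * a (n + 2) - ((n : K) + 3) * b (n + 1)) (n : ℕ) :
    derivative (P (n + 1)) = C ((n : K) + 1) * R n := by
  induction n using Nat.strong_induction_on with
  | _ n ih =>
    match n with
    | 0 => simp [hP1, hR0]
    | 1 => simp [hP2, hR1, one_add_one_eq_two]
    | 2 =>
      have hC : (C ((2 : ℕ) + 1 : K) : K[X]) = 3 := by
        rw [Nat.cast_ofNat, two_add_one_eq_three, map_ofNat]
      rw [hC, hPrec 0, hP0, hP2, hR2]
      simp
      ring
    | m + 3 =>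
      have hder := congrArg derivative (hPrec (m + 1))
      have hCc := congrArg C (hc m)
      have hrec := hRrec m
      have ih_near := ih (m + 2) (by lia)
      have ih_far := ih m (by lia)
      simp only [derivative_sub, derivative_mul, derivative_X, derivative_C] at hder
      simp only [C_sub, C_mul, C_add, C_1, Nat.cast_add, Nat.cast_ofNat, map_natCast,
        map_ofNat] at *
      linear_combination hder + X * ih_near - C (a (m + 2)) * ih_far + hconn m
        + R m * hCc - ((m : K[X]) + 3) * hrec

end ThreefoldSymmetric

/-- the monic derivatives of the case B₁ family with parameter μ
are the case B₂ family with parameter ρ = μ + 2. -/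
theorem caseB1_derivative_is_caseB2
    (μ : ℂ) (hμ : ∀ k : ℕ, μ + 3 * (k : ℂ) + 2 ≠ 0)
    (γP γR : ℕ → ℂ)
    (hγPodd : ∀ n : ℕ, γP (2 * n + 1) =
      (2 / 3 : ℂ) * ((n : ℂ) + 1) * (2 * (n : ℂ) + 1) / (3 * (n : ℂ) + μ + 2))
    (hγPeven : ∀ n : ℕ, γP (2 * n + 2) =
      (2 / 3 : ℂ) * ((n : ℂ) + 1) * (2 * (n : ℂ) + 3) * ((n : ℂ) + μ + 1) /
        ((3 * (n : ℂ) + μ + 2) * (3 * (n : ℂ) + μ + 5)))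
    (hγReven : ∀ n : ℕ, γR (2 * (n + 1)) =
      2 * ((n : ℂ) + 1) * (2 * ((n : ℂ) + 1) + 1) / (3 * (3 * ((n : ℂ) + 1) + (μ + 2))))
    (hγRodd : ∀ n : ℕ, γR (2 * n + 1) =
      2 * ((n : ℂ) + 1) * (2 * (n : ℂ) + 1) * ((n : ℂ) + (μ + 2)) /
        (3 * (3 * (n : ℂ) + (μ + 2)) * (3 * (n : ℂ) + (μ + 2) + 3)))
    (P R : ℕ → Polynomial ℂ)
    (hP0 : P 0 = 1) (hP1 : P 1 = X) (hP2 : P 2 = X ^ 2)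
    (hPrec : ∀ n : ℕ, P (n + 3) = X * P (n + 2) - C (γP (n + 1)) * P n)
    (hR0 : R 0 = 1) (hR1 : R 1 = X) (hR2 : R 2 = X ^ 2)
    (hRrec : ∀ n : ℕ, R (n + 3) = X * R (n + 2) - C (γR (n + 1)) * R n) :
    ∀ n : ℕ, derivative (P (n + 1)) = C ((n : ℂ) + 1) * R n := by
  have hden (k : ℕ) : 3 * (k : ℂ) + μ + 2 ≠ 0 := by
    convert hμ k using 1
    ring
  have hden_succ (k : ℕ) : 3 * (k : ℂ) + μ + 5 ≠ 0 := by
    convert hμ (k + 1) using 1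
    push_cast
    ring
  have hden_succ_succ (k : ℕ) : 3 * (k : ℂ) + μ + 8 ≠ 0 := by
    convert hμ (k + 2) using 1
    push_cast
    ring
  have hRodd (m : ℕ) : γR (2 * m + 1) = 2 * ((m : ℂ) + 1) * (2 * m + 1) * (m + μ + 2) /
      (3 * (3 * m + μ + 2) * (3 * m + μ + 5)) := by
    rw [hγRodd m]
    ring_nf
  have hReven (m : ℕ) : γR (2 * m + 2) = 2 * ((m : ℂ) + 1) * (2 * m + 3) /
      (3 * (3 * m + μ + 5)) := by
    rw [show 2 * m + 2 = 2 * (m + 1) by ring, hγReven m]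
    ring_nf
  have hPodd_succ (m : ℕ) : γP (2 * m + 3) = (2 / 3 : ℂ) * ((m : ℂ) + 2) * (2 * m + 3) /
      (3 * m + μ + 5) := by
    rw [show 2 * m + 3 = 2 * (m + 1) + 1 by ring, hγPodd (m + 1)]
    push_cast
    ring_nf
  have hPeven_succ (m : ℕ) : γP (2 * m + 4) = (2 / 3 : ℂ) * ((m : ℂ) + 2) * (2 * m + 5) *
      (m + μ + 2) / ((3 * m + μ + 5) * (3 * m + μ + 8)) := by
    rw [show 2 * m + 4 = 2 * (m + 1) + 2 by ring, hγPeven (m + 1)]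
    push_cast
    ring_nf
  have hRodd_succ (m : ℕ) : γR (2 * m + 3) = 2 * ((m : ℂ) + 2) * (2 * m + 3) * (m + μ + 3) /
      (3 * (3 * m + μ + 5) * (3 * m + μ + 8)) := by
    rw [show 2 * m + 3 = 2 * (m + 1) + 1 by ring, hRodd (m + 1)]
    push_cast
    ring_nf
  let c : ℕ → ℂ := fun n ↦ ((n : ℂ) + 1) * γP (n + 2) - ((n : ℂ) + 3) * γR (n + 1)
  have hc_even (m : ℕ) : c (2 * m) = -(2 / 3 : ℂ) * (m + 1) * (2 * m + 1) * (2 * m + 3) /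
      ((3 * m + μ + 2) * (3 * m + μ + 5)) := by
    have h2 := hden m
    have h5 := hden_succ m
    simp only [c, hγPeven, hRodd]
    push_cast
    field_simp
    ring
  have hc_odd (m : ℕ) : c (2 * m + 1) = 0 := by
    have h5 := hden_succ m
    simp only [c, add_assoc, Nat.reduceAdd, hPodd_succ, hReven]
    push_cast
    field_simp
    ring
  have hc_even_succ (m : ℕ) : c (2 * m + 2) = -(2 / 3 : ℂ) * (m + 2) * (2 * m + 3) *
      (2 * m + 5) / ((3 * m + μ + 5) * (3 * m + μ + 8)) := by
    rw [show 2 * m + 2 = 2 * (m + 1) by ring, hc_even (m + 1)]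
    push_cast
    ring_nf
  refine threefold_symmetric_derivative hP0 hP1 hP2 hPrec hR0 hR1 hR2 hRrec
    (threefold_symmetric_connection hP0 hP1 hP2 hPrec hR0 hR1 hR2 hRrec
      (c := c) ?_ ?_ ?_) fun _ ↦ rfl
  · have h2 := hden 0
    have h5 := hden_succ 0
    rw [hc_even 0, hRodd 0, hγPodd 0]
    field_simp
    ring
  · intro n
    obtain ⟨m, rfl | rfl⟩ := n.even_or_odd'
    · have h2 := hden m
      have h5 := hden_succ m
      rw [hc_odd, hc_even, hReven, hγPeven]
      field_simp
      ring
    · have h5 := hden_succ m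
      have h8 := hden_succ_succ m
      rw [hc_odd, hc_even_succ, hRodd_succ, hPodd_succ]
      field_simp
      ring
  · intro n
    obtain ⟨m, rfl | rfl⟩ := n.even_or_odd'
    · have h2 := hden m
      have h5 := hden_succ m
      have h8 := hden_succ_succ m
      rw [hc_even_succ, hc_even, hRodd, hPeven_succ]
      field_simp
    · rw [hc_odd, show 2 * m + 1 + 2 = 2 * (m + 1) + 1 by ring, hc_odd]
      ring
end

section
/- Let μ, ρ be real numbers with μ > −1 and ρ > 0, and let P_n(·; μ, ρ) be the monic polynomials defined by the threefold symmetric recurrence with coefficients γ_{2n}(μ,ρ) = 2n(2n+1)(n+μ)/((3n+μ−1)(3n+μ+2)(3n+ρ)) for n ≥ 1 and γ_{2n+1}(μ,ρ) = 2(n+1)(2n+1)(n+ρ)/((3n+μ+2)(3n+ρ)(3n+ρ+3)) for n ≥ 0 (case C of the threefold symmetric Hahn-classical 2-orthogonal polynomials). Then for every n ≥ 0: d/dX P_{n+1}(X; μ, ρ) = (n+1)·P_n(X; ρ+1, μ+2). -/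
open Polynomial

section ThreefoldRecurrence

variable {R : Type*} [CommRing R] {p q : ℕ → R[X]} {γ δ d : ℕ → R}

/-- Two threefold symmetric sequences are connected by `p (n + 3) = q (n + 3) + d n * q n`
as soon as the connection coefficients `d` are compatible with both recurrences. -/
theorem threefold_connection
    (hp0 : p 0 = 1) (hp1 : p 1 = X) (hp2 : p 2 = X ^ 2)
    (hp : ∀ n, p (n + 3) = X * p (n + 2) - C (γ (n + 1)) * p n)
    (hq0 : q 0 = 1) (hq1 : q 1 = X) (hq2 : q 2 = X ^ 2)
    (hq : ∀ n, q (n + 3) = X * q (n + 2) - C (δ (n + 1)) * q n)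
    (hd0 : d 0 = δ 1 - γ 1) (hd : ∀ n, d (n + 1) = d n + δ (n + 2) - γ (n + 2))
    (hmul : ∀ n, d (n + 2) * δ (n + 1) = γ (n + 4) * d n) (n : ℕ) :
    p (n + 3) = q (n + 3) + C (d n) * q n := by
  have h0 : p 3 = q 3 + C (d 0) * q 0 := by
    rw [hp 0, hq 0, hd0]
    simp only [zero_add, hp0, hp2, hq0, hq2, C_sub]
    ring
  have h1 : p 4 = q 4 + C (d 1) * q 1 := by
    rw [hp 1, hq 1, hd 0]
    simp only [Nat.reduceAdd, zero_add, h0, hp1, hq0, hq1, C_sub, C_add]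
    ring
  have h2 : p 5 = q 5 + C (d 2) * q 2 := by
    rw [hp 2, hq 2, hd 1]
    simp only [Nat.reduceAdd, h1, hp2, hq1, hq2, C_sub, C_add]
    ring
  induction n using Nat.strong_induction_on with
  | _ n ih =>
    match n, ih with
    | 0, _ => exact h0
    | 1, _ => exact h1
    | 2, _ => exact h2
    | k + 3, ih =>
      have hmulC : C (d (k + 2)) * C (δ (k + 1)) = C (γ (k + 4)) * C (d k) := by
        rw [← C_mul, hmul, C_mul]
      rw [hp (k + 3), hq (k + 3), hd (k + 2), ih (k + 2) (by lia), ih k (by lia)]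
      simp only [C_sub, C_add]
      linear_combination (C (d (k + 2))) * (-hq k) + q k * hmulC

/-- If the connection coefficients between `p` and `q` are
`(n + 1) * γ (n + 2) - (n + 3) * δ (n + 1)`, then `q` is the sequence of monic derivatives
of `p`. -/
theorem derivative_eq_of_threefold_connection
    (hp0 : p 0 = 1) (hp1 : p 1 = X) (hp2 : p 2 = X ^ 2)
    (hp : ∀ n, p (n + 3) = X * p (n + 2) - C (γ (n + 1)) * p n)
    (hq0 : q 0 = 1) (hq1 : q 1 = X) (hq2 : q 2 = X ^ 2)
    (hq : ∀ n, q (n + 3) = X * q (n + 2) - C (δ (n + 1)) * q n)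
    (hd : ∀ n : ℕ, d n = (n + 1) * γ (n + 2) - (n + 3) * δ (n + 1))
    (hpq : ∀ n, p (n + 3) = q (n + 3) + C (d n) * q n) (n : ℕ) :
    derivative (p (n + 1)) = C ((n : R) + 1) * q n := by
  induction n using Nat.strong_induction_on with
  | _ n ih =>
    match n, ih with
    | 0, _ => simp [hp1, hq0]
    | 1, _ => simp [hp2, hq1, one_add_one_eq_two]
    | 2, _ =>
      rw [hp 0, hp0, hq2]
      simp only [zero_add, hp2, derivative_sub, derivative_mul, derivative_X, derivative_C,
        derivative_X_sq, derivative_one, C_add, C_1, Nat.cast_ofNat, C_ofNat]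
      ring
    | k + 3, ih =>
      have h2 := ih (k + 2) (by lia)
      have h0 := ih k (by lia)
      have hdC : C (d k) = C ((k : R) + 1) * C (γ (k + 2)) - C ((k : R) + 3) * C (δ (k + 1)) := by
        rw [hd, C_sub, C_mul, C_mul]
      rw [hp (k + 1), derivative_sub, derivative_mul, derivative_mul, derivative_X,
        derivative_C, h2, h0, hpq, hdC]
      push_cast
      simp only [C_add, C_1, C_ofNat]
      linear_combination (-(C (k : R)) - 3) * hq k

end ThreefoldRecurrence

/-- Case C: the monic derivative of P_{n+1}(·;μ,ρ) is
P_n(·;ρ+1,μ+2). -/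
theorem caseC_derivative_parameter_shift
    (μ ρ : ℝ) (hμ : -1 < μ) (hρ : 0 < ρ)
    (g : ℝ → ℝ → ℕ → ℂ)
    (hgeven : ∀ (a b : ℝ) (n : ℕ), g a b (2 * (n + 1)) =
      2 * ((n : ℂ) + 1) * (2 * ((n : ℂ) + 1) + 1) * (((n : ℂ) + 1) + (a : ℂ)) /
        ((3 * ((n : ℂ) + 1) + (a : ℂ) - 1) * (3 * ((n : ℂ) + 1) + (a : ℂ) + 2) *
          (3 * ((n : ℂ) + 1) + (b : ℂ))))
    (hgodd : ∀ (a b : ℝ) (n : ℕ), g a b (2 * n + 1) =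
      2 * ((n : ℂ) + 1) * (2 * (n : ℂ) + 1) * ((n : ℂ) + (b : ℂ)) /
        ((3 * (n : ℂ) + (a : ℂ) + 2) * (3 * (n : ℂ) + (b : ℂ)) *
          (3 * (n : ℂ) + (b : ℂ) + 3)))
    (P : ℝ → ℝ → ℕ → Polynomial ℂ)
    (hP0 : ∀ a b : ℝ, P a b 0 = 1) (hP1 : ∀ a b : ℝ, P a b 1 = X)
    (hP2 : ∀ a b : ℝ, P a b 2 = X ^ 2)
    (hPrec : ∀ (a b : ℝ) (n : ℕ), P a b (n + 3) =
      X * P a b (n + 2) - C (g a b (n + 1)) * P a b n) :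
    ∀ n : ℕ, derivative (P μ ρ (n + 1)) = C ((n : ℂ) + 1) * P (ρ + 1) (μ + 2) n := by
  have hre : ∀ z : ℝ, 0 < z → (z : ℂ) ≠ 0 := fun z hz => by exact_mod_cast hz.ne'
  have hu : ∀ n : ℕ, (3 * n + μ + 2 : ℂ) ≠ 0 := fun n => by
    exact_mod_cast hre (3 * n + μ + 2) (by linarith [(Nat.cast_nonneg n : (0 : ℝ) ≤ n)])
  have hv : ∀ n : ℕ, (3 * n + ρ : ℂ) ≠ 0 := fun n => by
    exact_mod_cast hre (3 * n + ρ) (by positivity)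
  have hu' : ∀ n : ℕ, (3 * n + μ + 5 : ℂ) ≠ 0 := fun n => by
    convert hu (n + 1) using 1; push_cast; ring
  have hv' : ∀ n : ℕ, (3 * n + ρ + 3 : ℂ) ≠ 0 := fun n => by
    convert hv (n + 1) using 1; push_cast; ring
  have hu'' : ∀ n : ℕ, (3 * n + μ + 8 : ℂ) ≠ 0 := fun n => by
    convert hu (n + 2) using 1; push_cast; ring
  have hv'' : ∀ n : ℕ, (3 * n + ρ + 6 : ℂ) ≠ 0 := fun n => by
    convert hv (n + 2) using 1; push_cast; ring
  have heven : ∀ n : ℕ, g μ ρ (2 * n + 2) = 2 * (n + 1) * (2 * n + 3) * (n + 1 + μ) /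
      ((3 * n + μ + 2) * (3 * n + μ + 5) * (3 * n + ρ + 3)) := fun n => by
    rw [show 2 * n + 2 = 2 * (n + 1) by ring, hgeven]
    congr 1 <;> ring
  have hodd : ∀ n : ℕ, g μ ρ (2 * n + 3) = 2 * (n + 2) * (2 * n + 3) * (n + 1 + ρ) /
      ((3 * n + μ + 5) * (3 * n + ρ + 3) * (3 * n + ρ + 6)) := fun n => by
    rw [show 2 * n + 3 = 2 * (n + 1) + 1 by ring, hgodd]
    push_cast
    congr 1 <;> ring
  have hone : g μ ρ 1 = 2 / ((μ + 2) * (ρ + 3)) := by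
    have h := hgodd μ ρ 0
    have hρ0 := hre ρ hρ
    simp only [mul_zero, zero_add, Nat.cast_zero, mul_one] at h
    rw [h, show (μ + 2 : ℂ) * ρ * (ρ + 3) = (μ + 2) * (ρ + 3) * ρ by ring,
      mul_div_mul_right _ _ hρ0]
  have heven' : ∀ n : ℕ, g (ρ + 1) (μ + 2) (2 * n + 2) =
      2 * (n + 1) * (2 * n + 3) * (n + ρ + 2) /
        ((3 * n + ρ + 3) * (3 * n + ρ + 6) * (3 * n + μ + 5)) := fun n => by
    rw [show 2 * n + 2 = 2 * (n + 1) by ring, hgeven]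
    push_cast
    congr 1 <;> ring
  have hodd' : ∀ n : ℕ, g (ρ + 1) (μ + 2) (2 * n + 1) =
      2 * (n + 1) * (2 * n + 1) * (n + μ + 2) /
        ((3 * n + ρ + 3) * (3 * n + μ + 2) * (3 * n + μ + 5)) := fun n => by
    rw [hgodd]
    push_cast
    congr 1 <;> ring
  let d : ℕ → ℂ := fun n =>
    (n + 1) * g μ ρ (n + 2) - (n + 3) * g (ρ + 1) (μ + 2) (n + 1)
  have hdeven : ∀ n : ℕ, d (2 * n) = -(2 * (n + 1) * (2 * n + 1) * (2 * n + 3)) /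
      ((3 * n + μ + 2) * (3 * n + μ + 5) * (3 * n + ρ + 3)) := fun n => by
    simp only [d, heven, hodd']
    push_cast
    ring
  have hdodd : ∀ n : ℕ, d (2 * n + 1) = -(4 * (n + 1) * (n + 2) * (2 * n + 3)) /
      ((3 * n + μ + 5) * (3 * n + ρ + 3) * (3 * n + ρ + 6)) := fun n => by
    simp only [d, add_assoc, Nat.reduceAdd]
    simp only [hodd, heven']
    push_cast
    ring
  have hdeven' : ∀ n : ℕ, d (2 * n + 2) = -(2 * (n + 2) * (2 * n + 3) * (2 * n + 5)) /
      ((3 * n + μ + 5) * (3 * n + μ + 8) * (3 * n + ρ + 6)) := fun n => by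
    rw [show 2 * n + 2 = 2 * (n + 1) by ring, hdeven]
    push_cast
    congr 1 <;> ring
  have hdodd' : ∀ n : ℕ, d (2 * n + 3) = -(4 * (n + 2) * (n + 3) * (2 * n + 5)) /
      ((3 * n + μ + 8) * (3 * n + ρ + 6) * (3 * n + ρ + 9)) := fun n => by
    rw [show 2 * n + 3 = 2 * (n + 1) + 1 by ring, hdodd]
    push_cast
    congr 1 <;> ring
  have hodd3' : ∀ n : ℕ, g (ρ + 1) (μ + 2) (2 * n + 3) =
      2 * (n + 2) * (2 * n + 3) * (n + μ + 3) /
        ((3 * n + ρ + 6) * (3 * n + μ + 5) * (3 * n + μ + 8)) := fun n => by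
    rw [show 2 * n + 3 = 2 * (n + 1) + 1 by ring, hodd']
    push_cast
    congr 1 <;> ring
  have heven4 : ∀ n : ℕ, g μ ρ (2 * n + 4) = 2 * (n + 2) * (2 * n + 5) * (n + 2 + μ) /
      ((3 * n + μ + 5) * (3 * n + μ + 8) * (3 * n + ρ + 6)) := fun n => by
    rw [show 2 * n + 4 = 2 * (n + 1) + 2 by ring, heven]
    push_cast
    congr 1 <;> ring
  have hodd5 : ∀ n : ℕ, g μ ρ (2 * n + 5) = 2 * (n + 3) * (2 * n + 5) * (n + 2 + ρ) /
      ((3 * n + μ + 8) * (3 * n + ρ + 6) * (3 * n + ρ + 9)) := fun n => by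
    rw [show 2 * n + 5 = 2 * (n + 1) + 3 by ring, hodd]
    push_cast
    congr 1 <;> ring
  have hd0 : d 0 = g (ρ + 1) (μ + 2) 1 - g μ ρ 1 := by
    have h := hdeven 0
    have h' := hodd' 0
    have hu0 := hu 0
    have hu0' := hu' 0
    have hv0' := hv' 0
    simp only [mul_zero, zero_add, Nat.cast_zero, mul_one] at h h' hu0 hu0' hv0'
    rw [h, h', hone]
    field_simp
    ring
  have hdsucc : ∀ n, d (n + 1) = d n + g (ρ + 1) (μ + 2) (n + 2) - g μ ρ (n + 2) := fun n => by
    obtain ⟨k, rfl | rfl⟩ := n.even_or_odd'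
    · have hsub : d (2 * k + 1) - g (ρ + 1) (μ + 2) (2 * k + 2) =
          -(2 * (k + 1) * (2 * k + 3)) / ((3 * k + μ + 5) * (3 * k + ρ + 3)) := by
        rw [hdodd, heven',
          ← mul_div_mul_right (-(2 * ((k : ℂ) + 1) * (2 * k + 3))) _ (hv'' k)]
        ring
      have hsub' : d (2 * k) - g μ ρ (2 * k + 2) =
          -(2 * (k + 1) * (2 * k + 3)) / ((3 * k + μ + 5) * (3 * k + ρ + 3)) := by
        rw [hdeven, heven,
          ← mul_div_mul_right (-(2 * ((k : ℂ) + 1) * (2 * k + 3))) _ (hu k)]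
        ring
      linear_combination hsub - hsub'
    · have hsub : d (2 * k + 2) - g (ρ + 1) (μ + 2) (2 * k + 3) =
          -(2 * (k + 2) * (2 * k + 3)) / ((3 * k + μ + 5) * (3 * k + ρ + 6)) := by
        rw [hdeven', hodd3',
          ← mul_div_mul_right (-(2 * ((k : ℂ) + 2) * (2 * k + 3))) _ (hu'' k)]
        ring
      have hsub' : d (2 * k + 1) - g μ ρ (2 * k + 3) =
          -(2 * (k + 2) * (2 * k + 3)) / ((3 * k + μ + 5) * (3 * k + ρ + 6)) := by
        rw [hdodd, hodd,
          ← mul_div_mul_right (-(2 * ((k : ℂ) + 2) * (2 * k + 3))) _ (hv' k)]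
        ring
      simp only [add_assoc, Nat.reduceAdd]
      linear_combination hsub - hsub'
  have hmul : ∀ n, d (n + 2) * g (ρ + 1) (μ + 2) (n + 1) = g μ ρ (n + 4) * d n := fun n => by
    obtain ⟨k, rfl | rfl⟩ := n.even_or_odd'
    · rw [hdeven', hodd', heven4, hdeven, div_mul_div_comm, div_mul_div_comm]
      congr 1 <;> ring
    · simp only [add_assoc, Nat.reduceAdd]
      rw [hdodd', heven', hodd5, hdodd, div_mul_div_comm, div_mul_div_comm]
      congr 1 <;> ring
  have hconn := threefold_connection (hP0 μ ρ) (hP1 μ ρ) (hP2 μ ρ) (hPrec μ ρ)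
    (hP0 (ρ + 1) (μ + 2)) (hP1 _ _) (hP2 _ _) (hPrec _ _) hd0 hdsucc hmul
  exact derivative_eq_of_threefold_connection (hP0 μ ρ) (hP1 μ ρ) (hP2 μ ρ) (hPrec μ ρ)
    (hP0 (ρ + 1) (μ + 2)) (hP1 _ _) (hP2 _ _) (hPrec _ _) (fun _ => rfl) hconn
end
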